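/- arXiv:1405.7817 — 7 statements merged into one kernel-verified Lean document; each statement's English description precedes it below -/
import Mathlib

section
/- Let H be a real separable Hilbert space, G ⊂ H a closed subset, and A : G → H a bounded, demicontinuous operator of class (S₊). Let {F_k}_{k∈ℕ} be finite-dimensional subspaces of H with dim F_k = k, F_k ⊂ F_{k+1} and ⋃_k F_k dense in H, and let h ∈ H. Suppose {u_k}_{k∈ℕ} is a bounded sequence with u_k ∈ G ∩ F_k and ⟨A(u_k), v⟩ = ⟨h, v⟩ for all v ∈ F_k (Galerkin approximations). Then there exist a subsequence of {u_k} converging in norm to some u ∈ G, and this limit satisfies A(u) = h. -/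
open Filter Topology

/-- A bounded sequence in a separable Hilbert space has a weakly convergent subsequence. -/
theorem exists_subseq_tendsto_inner {H : Type*} [NormedAddCommGroup H] [InnerProductSpace ℝ H]
    [CompleteSpace H] [TopologicalSpace.SeparableSpace H] {u : ℕ → H} {C : ℝ}
    (hu : ∀ k, ‖u k‖ ≤ C) :
    ∃ (u₀ : H) (φ : ℕ → ℕ), StrictMono φ ∧
      ∀ v : H, Tendsto (fun k => inner ℝ v (u (φ k))) atTop (𝓝 (inner ℝ v u₀)) := by
  obtain ⟨f, -, φ, hφ, hf⟩ := WeakDual.isSeqCompact_closedBall ℝ H 0 C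
    (x := fun k => StrongDual.toWeakDual (InnerProductSpace.toDual ℝ H (u k)))
    (fun k => by simpa using hu k)
  refine ⟨(InnerProductSpace.toDual ℝ H).symm (WeakDual.toStrongDual f), φ, hφ, fun v => ?_⟩
  have hv := ((WeakDual.eval_continuous v).tendsto f).comp hf
  rw [real_inner_comm, InnerProductSpace.toDual_symm_apply]
  refine hv.congr fun k => ?_
  exact real_inner_comm _ _

/-- If a bounded sequence is eventually orthogonal to each vector of a dense set, then it
converges weakly to zero. -/
theorem tendsto_inner_zero_of_dense {H : Type*} [NormedAddCommGroup H] [InnerProductSpace ℝ H]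
    {a : ℕ → H} {C : ℝ} (ha : ∀ k, ‖a k‖ ≤ C) {D : Set H} (hD : Dense D)
    (hortho : ∀ v ∈ D, ∀ᶠ k in atTop, inner ℝ (a k) v = 0) (v : H) :
    Tendsto (fun k => inner ℝ (a k) v) atTop (𝓝 0) := by
  have hC : 0 ≤ C := (norm_nonneg _).trans (ha 0)
  rw [Metric.tendsto_nhds]
  intro ε hε
  obtain ⟨w, hw, hvw⟩ := hD.exists_dist_lt v (show 0 < ε / (C + 1) by positivity)
  filter_upwards [hortho w hw] with k hk
  have hsub : inner ℝ (a k) v = inner ℝ (a k) (v - w) := by rw [inner_sub_right, hk, sub_zero]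
  rw [dist_zero_right, hsub]
  rw [dist_eq_norm, lt_div_iff₀ (by positivity)] at hvw
  calc ‖inner ℝ (a k) (v - w)‖ ≤ ‖a k‖ * ‖v - w‖ := norm_inner_le_norm _ _
    _ ≤ C * ‖v - w‖ := by gcongr; exact ha k
    _ < ε := by nlinarith [norm_nonneg (v - w)]

/-- Improving convergence of Galerkin approximations for a bounded
demicontinuous operator of class `(S₊)` on a closed subset of a real separable Hilbert space:
a bounded sequence of solutions of the Galerkin approximations has a subsequence converging
in norm to a solution `u ∈ G` of `A(u) = h`. -/
theorem stmt_3 {H : Type*} [NormedAddCommGroup H] [InnerProductSpace ℝ H] [CompleteSpace H]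
    [TopologicalSpace.SeparableSpace H]
    (G : Set H) (hG : IsClosed G) (A : H → H)
    (hbdd : ∀ s : Set H, s ⊆ G → Bornology.IsBounded s → Bornology.IsBounded (A '' s))
    (hdemi : ∀ (u : ℕ → H), (∀ k, u k ∈ G) → ∀ u₀ ∈ G, Tendsto u atTop (𝓝 u₀) →
      ∀ v : H, Tendsto (fun k => (inner ℝ (A (u k)) v : ℝ)) atTop (𝓝 (inner ℝ (A u₀) v)))
    (hSplus : ∀ (u : ℕ → H) (u₀ : H), (∀ k, u k ∈ G) →
      (∀ v : H, Tendsto (fun k => (inner ℝ v (u k) : ℝ)) atTop (𝓝 (inner ℝ v u₀))) →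
      Filter.limsup (fun k => (((inner ℝ (A (u k)) (u k - u₀) : ℝ)) : EReal)) atTop ≤ (0 : EReal) →
      Tendsto u atTop (𝓝 u₀))
    (F : ℕ → Submodule ℝ H)
    (hfin : ∀ k, FiniteDimensional ℝ (F k))
    (hdim : ∀ k, Module.finrank ℝ (F k) = k)
    (hmonoF : ∀ k, F k ≤ F (k + 1))
    (hdenseF : Dense (⋃ k, (F k : Set H)))
    (h : H) (u : ℕ → H)
    (hbound : ∃ C : ℝ, ∀ k, ‖u k‖ ≤ C)
    (huG : ∀ k, u k ∈ G) (huF : ∀ k, u k ∈ F k)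
    (hGal : ∀ k, ∀ v ∈ F k, (inner ℝ (A (u k)) v : ℝ) = inner ℝ h v) :
    ∃ (u₀ : H) (φ : ℕ → ℕ), u₀ ∈ G ∧ StrictMono φ ∧
      Tendsto (u ∘ φ) atTop (𝓝 u₀) ∧ A u₀ = h := by
  obtain ⟨C, hC⟩ := hbound
  obtain ⟨u₀, φ, hφ, hweak⟩ := exists_subseq_tendsto_inner hC
  obtain ⟨M, hM⟩ := (hbdd (Set.range u) (Set.range_subset_iff.2 huG)
    (isBounded_iff_forall_norm_le.2 ⟨C, Set.forall_mem_range.2 hC⟩)).exists_norm_le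
  have hres : ∀ k, ‖A (u k) - h‖ ≤ M + ‖h‖ := fun k =>
    (norm_sub_le _ _).trans (by gcongr; exact hM _ ⟨u k, ⟨k, rfl⟩, rfl⟩)
  have hA : ∀ v, Tendsto (fun k => inner ℝ (A (u k)) v) atTop (𝓝 (inner ℝ h v)) := by
    intro v
    have hzero := tendsto_inner_zero_of_dense hres hdenseF (fun w hw => ?_) v
    · simpa [inner_sub_left] using hzero.add_const (inner ℝ h v)
    · obtain ⟨n, hn⟩ := Set.mem_iUnion.1 hw
      filter_upwards [eventually_ge_atTop n] with k hk
      rw [inner_sub_left, hGal k w (monotone_nat_of_le_succ hmonoF hk hn), sub_self]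
  have hpair : Tendsto (fun k => inner ℝ (A (u (φ k))) (u (φ k) - u₀)) atTop (𝓝 0) := by
    have hdiff := (hweak h).sub ((hA u₀).comp hφ.tendsto_atTop)
    rw [sub_self] at hdiff
    refine hdiff.congr fun k => ?_
    rw [inner_sub_right, hGal _ _ (huF _), Function.comp_apply]
  have hconv : Tendsto (u ∘ φ) atTop (𝓝 u₀) :=
    hSplus _ u₀ (fun k => huG _) hweak (EReal.tendsto_coe.2 hpair).limsup_eq.le
  have hu₀ : u₀ ∈ G := hG.mem_of_tendsto hconv (Eventually.of_forall fun k => huG _)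
  refine ⟨u₀, φ, hu₀, hφ, hconv, ext_inner_right ℝ fun v => ?_⟩
  exact tendsto_nhds_unique (hdemi _ (fun k => huG _) u₀ hu₀ hconv v)
    ((hA v).comp hφ.tendsto_atTop)
end

section
/- Let H be a complex Hilbert space with an orthogonal decomposition H = H₁ ⊕ H₂ where H₁ is finite-dimensional, and let P₂ denote the orthogonal projection onto H₂. If N : H → H is bounded and quasi-monotone, then the operator N₂ = P₂ ∘ N is quasi-monotone; that is, for every sequence u_k ⇀ u weakly in H one has limsup_{k→∞} Re⟨P₂N(u_k), P₂(u_k − u)⟩ ≥ 0. -/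
open Filter Topology

/-- A weakly convergent sequence in a Hilbert space has bounded range. -/
theorem isBounded_range_of_tendsto_inner {𝕜 H : Type*} [RCLike 𝕜] [NormedAddCommGroup H]
    [InnerProductSpace 𝕜 H] [CompleteSpace H] {u : ℕ → H} {u₀ : H}
    (hu : ∀ v : H, Tendsto (fun k => inner 𝕜 v (u k)) atTop (𝓝 (inner 𝕜 v u₀))) :
    Bornology.IsBounded (Set.range u) := by
  obtain ⟨C, hC⟩ := banach_steinhaus (g := fun k => innerSL 𝕜 (u k)) fun v => by
    obtain ⟨C, hC⟩ := (Metric.isBounded_range_of_tendsto _ (hu v)).exists_norm_le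
    refine ⟨C, fun k => ?_⟩
    rw [innerSL_apply_apply, norm_inner_symm]
    exact hC _ ⟨k, rfl⟩
  refine isBounded_iff_forall_norm_le.2 ⟨C, ?_⟩
  rintro _ ⟨k, rfl⟩
  simpa only [innerSL_apply_norm] using hC k

/-- The orthogonal projection onto a finite-dimensional subspace maps weakly convergent sequences
to norm convergent ones. -/
theorem tendsto_starProjection_of_tendsto_inner {𝕜 H ι : Type*} [RCLike 𝕜]
    [NormedAddCommGroup H] [InnerProductSpace 𝕜 H] (K : Submodule 𝕜 H) [FiniteDimensional 𝕜 K]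
    {l : Filter ι} {u : ι → H} {u₀ : H}
    (hu : ∀ v : H, Tendsto (fun k => inner 𝕜 v (u k)) l (𝓝 (inner 𝕜 v u₀))) :
    Tendsto (fun k => K.starProjection (u k)) l (𝓝 (K.starProjection u₀)) := by
  have key (x : H) : K.starProjection x = ∑ i, inner 𝕜 (stdOrthonormalBasis 𝕜 K i : H) x •
      (stdOrthonormalBasis 𝕜 K i : H) := by
    rw [Submodule.starProjection_apply,
      (stdOrthonormalBasis 𝕜 K).orthogonalProjectionOnto_apply_eq_sum x]
    simp
  simp only [key]
  exact tendsto_finsetSum _ fun i _ => (hu _).smul_const _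

/-- A null perturbation of a real sequence preserves nonnegativity of the extended upper limit. -/
theorem zero_le_limsup_of_tendsto_sub {ι : Type*} {l : Filter ι} {a b : ι → ℝ}
    (ha : (0 : EReal) ≤ limsup (fun k => (a k : EReal)) l)
    (hab : Tendsto (fun k => b k - a k) l (𝓝 0)) :
    (0 : EReal) ≤ limsup (fun k => (b k : EReal)) l := by
  rw [le_limsup_iff] at ha ⊢
  intro y hy
  obtain ⟨r, hyr, hr⟩ := EReal.lt_iff_exists_real_btwn.1 hy
  have hr' : r < 0 := by exact_mod_cast hr
  have hfreq := ha ((r / 2 : ℝ) : EReal) (by exact_mod_cast (by linarith : r / 2 < 0))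
  have hev := hab.eventually (lt_mem_nhds (by linarith : r / 2 < 0))
  refine (hfreq.and_eventually hev).mono fun k hk => hyr.trans ?_
  have h1 : r / 2 < a k := by exact_mod_cast hk.1
  have h2 := hk.2
  exact_mod_cast (by linarith : r < b k)

/-- If `H = H₁ ⊕ H₂` is an orthogonal decomposition of a complex Hilbert
space with `H₁` finite-dimensional and `P₂` the orthogonal projection onto `H₂ = H₁ᗮ`, then
for a bounded quasi-monotone operator `N : H → H` the operator `P₂ ∘ N` is quasi-monotone. -/
theorem stmt_4 {H : Type*} [NormedAddCommGroup H] [InnerProductSpace ℂ H] [CompleteSpace H]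
    (H₁ : Submodule ℂ H) (hfd : FiniteDimensional ℂ H₁)
    (P₂ : H → H)
    (hP₂mem : ∀ u : H, P₂ u ∈ H₁ᗮ) (hP₂orth : ∀ u : H, u - P₂ u ∈ H₁)
    (N : H → H)
    (hbdd : ∀ s : Set H, Bornology.IsBounded s → Bornology.IsBounded (N '' s))
    (hqm : ∀ (u : ℕ → H) (u₀ : H),
      (∀ v : H, Tendsto (fun k => (inner ℂ v (u k) : ℂ)) atTop (𝓝 (inner ℂ v u₀))) →
      (0 : EReal) ≤
        Filter.limsup (fun k => (((inner ℂ (N (u k)) (u k - u₀) : ℂ).re : ℝ) : EReal)) atTop)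
    (u : ℕ → H) (u₀ : H)
    (hweak : ∀ v : H, Tendsto (fun k => (inner ℂ v (u k) : ℂ)) atTop (𝓝 (inner ℂ v u₀))) :
    (0 : EReal) ≤
      Filter.limsup
        (fun k => (((inner ℂ (P₂ (N (u k))) (P₂ (u k - u₀)) : ℂ).re : ℝ) : EReal)) atTop := by
  have hP (x : H) : P₂ x = x - H₁.starProjection x := by
    rw [Submodule.eq_starProjection_of_mem_orthogonal (hP₂orth x) (by simpa using hP₂mem x)]
    simp
  refine zero_le_limsup_of_tendsto_sub (hqm u u₀ hweak) ?_
  have heq (k : ℕ) : (inner ℂ (P₂ (N (u k))) (P₂ (u k - u₀)) : ℂ).re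
      - (inner ℂ (N (u k)) (u k - u₀) : ℂ).re
      = (-inner ℂ (N (u k)) (H₁.starProjection (u k - u₀)) : ℂ).re := by
    have h := Submodule.inner_right_of_mem_orthogonal
      (H₁.starProjection_apply_mem (N (u k))) (hP₂mem (u k - u₀))
    rw [hP (N (u k)), inner_sub_left, h, sub_zero, hP (u k - u₀), inner_sub_right,
      ← Complex.sub_re]
    ring_nf
  simp only [heq]
  obtain ⟨C, hC⟩ := (hbdd _ (isBounded_range_of_tendsto_inner hweak)).exists_norm_le
  have hproj : Tendsto (fun k => C * ‖H₁.starProjection (u k - u₀)‖) atTop (𝓝 0) := by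
    have h := (tendsto_starProjection_of_tendsto_inner H₁ hweak).sub_const
      (H₁.starProjection u₀)
    simpa using h.norm.const_mul C
  refine squeeze_zero_norm (fun k => ?_) hproj
  calc ‖(-inner ℂ (N (u k)) (H₁.starProjection (u k - u₀)) : ℂ).re‖
      ≤ ‖(-inner ℂ (N (u k)) (H₁.starProjection (u k - u₀)) : ℂ)‖ := Complex.abs_re_le_norm _
    _ ≤ ‖N (u k)‖ * ‖H₁.starProjection (u k - u₀)‖ := by
      rw [norm_neg]
      exact norm_inner_le_norm _ _
    _ ≤ C * ‖H₁.starProjection (u k - u₀)‖ := by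
      gcongr
      exact hC _ ⟨u k, ⟨k, rfl⟩, rfl⟩
end

section
/- Let H be a complex Hilbert space and N : H → H an operator such that for every sequence {u_k} ⊂ H with ‖u_k‖ → +∞ one has limsup_{k→∞} Re⟨N(u_k), u_k⟩ / ‖u_k‖ > 0. Then for every u ∈ H with u ≠ 0 and J_N(u) > −∞, one has J_N(u) ≥ 0. -/
open Filter Topology

/-- The recession functional `J_N` of an operator `N` on a complex Hilbert space:
`J_N(u) = inf { liminf_k Re⟪N(t_k v_k), v_k⟫ : t_k → +∞, t_k > 0, v_k ⇀ u weakly }`,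
with values in the extended reals. -/
noncomputable def recessionFunctional {H : Type*} [NormedAddCommGroup H]
    [InnerProductSpace ℂ H] (N : H → H) (u : H) : EReal :=
  sInf { J : EReal | ∃ (t : ℕ → ℝ) (v : ℕ → H),
    (∀ k, 0 < t k) ∧ Tendsto t atTop atTop ∧
    (∀ w : H, Tendsto (fun k => (inner ℂ w (v k) : ℂ)) atTop (𝓝 (inner ℂ w u))) ∧
    J = Filter.liminf
      (fun k => (((inner ℂ (N ((t k : ℂ) • v k)) (v k) : ℂ).re : ℝ) : EReal)) atTop }

/-- If `v k ⇀ u ≠ 0` weakly and `t k → +∞` with `t k > 0`, then `‖t k • v k‖ → +∞`. -/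
theorem tendsto_norm_smul_atTop_of_weak {H : Type*} [NormedAddCommGroup H]
    [InnerProductSpace ℂ H] {u : H} (hu : u ≠ 0) {t : ℕ → ℝ} {v : ℕ → H}
    (ht : ∀ k, 0 < t k) (htop : Tendsto t atTop atTop)
    (hweak : ∀ w : H, Tendsto (fun k => (inner ℂ w (v k) : ℂ)) atTop (𝓝 (inner ℂ w u))) :
    Tendsto (fun k => ‖(t k : ℂ) • v k‖) atTop atTop := by
  have hu' : 0 < ‖u‖ := norm_pos_iff.mpr hu
  have hpos : 0 < ‖(inner ℂ u u : ℂ)‖ := norm_pos_iff.mpr (inner_self_ne_zero.mpr hu)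
  refine tendsto_atTop_mono (fun k => ?_)
    ((htop.atTop_mul_pos hpos (hweak u).norm).atTop_div_const hu')
  rw [norm_smul, Complex.norm_real, Real.norm_of_nonneg (ht k).le, div_le_iff₀ hu', mul_assoc,
    mul_comm ‖v k‖]
  exact mul_le_mul_of_nonneg_left (norm_inner_le_norm _ _) (ht k).le

/-- If `limsup Re⟪N(u_k), u_k⟫/‖u_k‖ > 0` for every sequence with
`‖u_k‖ → +∞`, then `J_N(u) ≥ 0` for every `u ≠ 0` with `J_N(u) > −∞`. -/
theorem stmt_7 {H : Type*} [NormedAddCommGroup H] [InnerProductSpace ℂ H] [CompleteSpace H]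
    (N : H → H)
    (hsign : ∀ u : ℕ → H, Tendsto (fun k => ‖u k‖) atTop atTop →
      (0 : EReal) < Filter.limsup
        (fun k => ((((inner ℂ (N (u k)) (u k) : ℂ).re / ‖u k‖ : ℝ)) : EReal)) atTop) :
    ∀ u : H, u ≠ 0 → (⊥ : EReal) < recessionFunctional N u → (0 : EReal) ≤ recessionFunctional N u := by
  intro u hu _
  refine le_sInf ?_
  rintro J ⟨t, v, ht, htop, hweak, rfl⟩
  by_contra! hlt
  obtain ⟨φ, hφ, hneg⟩ := extraction_of_frequently_atTop (frequently_lt_of_liminf_lt (h := hlt))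
  refine (hsign _ ((tendsto_norm_smul_atTop_of_weak hu ht htop hweak).comp
    hφ.tendsto_atTop)).not_ge ?_
  refine limsup_le_of_le (h := Eventually.of_forall fun k => ?_)
  have hk : (inner ℂ (N ((t (φ k) : ℂ) • v (φ k))) (v (φ k)) : ℂ).re < 0 := by
    exact_mod_cast hneg k
  simp only [inner_smul_right, Complex.re_ofReal_mul]
  exact_mod_cast div_nonpos_of_nonpos_of_nonneg
    (mul_nonpos_of_nonneg_of_nonpos (ht (φ k)).le hk.le) (norm_nonneg _)
end

section
/- Let H be a complex Hilbert space, let φ : [0, ∞) → [0, ∞) be continuous, let P_B be the metric projection onto the closed unit ball (P_B(u) = u if ‖u‖ ≤ 1, P_B(u) = u/‖u‖ if ‖u‖ > 1), and define N(u) = φ(‖u‖) P_B(u). Then N is bounded, continuous and quasi-monotone, and for every sequence {u_k} ⊂ H with ‖u_k‖ → +∞ one has limsup_{k→∞} Re⟨N(u_k), u_k⟩/‖u_k‖ = limsup_{k→∞} φ(‖u_k‖). -/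
open Filter Topology

/-- The metric projection onto the closed unit ball of a Hilbert space:
`P_B(u) = u` if `‖u‖ ≤ 1`, and `P_B(u) = u/‖u‖` otherwise. -/
noncomputable def ballProjection {H : Type*} [NormedAddCommGroup H]
    [InnerProductSpace ℂ H] (u : H) : H :=
  if ‖u‖ ≤ 1 then u else ((‖u‖⁻¹ : ℝ) : ℂ) • u

theorem ballProjection_eq_smul {H : Type*} [NormedAddCommGroup H] [InnerProductSpace ℂ H] (u : H) :
    ballProjection u = (((max 1 ‖u‖)⁻¹ : ℝ) : ℂ) • u := by
  unfold ballProjection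
  split_ifs with h
  · simp [max_eq_left h]
  · rw [max_eq_right (not_le.mp h).le]

theorem norm_ballProjection_le_one {H : Type*} [NormedAddCommGroup H] [InnerProductSpace ℂ H]
    (u : H) : ‖ballProjection u‖ ≤ 1 := by
  have hpos : 0 < max 1 ‖u‖ := lt_max_of_lt_left one_pos
  rw [ballProjection_eq_smul, norm_smul, Complex.norm_real, Real.norm_of_nonneg (by positivity),
    inv_mul_le_iff₀ hpos, mul_one]
  exact le_max_right _ _

theorem continuous_ballProjection {H : Type*} [NormedAddCommGroup H] [InnerProductSpace ℂ H] :
    Continuous (ballProjection : H → H) := by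
  have h : (ballProjection : H → H) = fun u => (((max 1 ‖u‖)⁻¹ : ℝ) : ℂ) • u :=
    funext ballProjection_eq_smul
  rw [h]
  refine Continuous.smul (Complex.continuous_ofReal.comp ?_) continuous_id
  exact (continuous_const.max continuous_norm).inv₀
    fun u => (lt_max_of_lt_left one_pos).ne'

/-- A weakly convergent sequence in a Hilbert space is norm bounded. -/
theorem exists_norm_le_of_tendsto_inner {H : Type*} [NormedAddCommGroup H] [InnerProductSpace ℂ H]
    [CompleteSpace H] {u : ℕ → H} {u₀ : H}
    (hu : ∀ v : H, Tendsto (fun k => (inner ℂ v (u k) : ℂ)) atTop (𝓝 (inner ℂ v u₀))) :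
    ∃ R : ℝ, ∀ k, ‖u k‖ ≤ R := by
  have hpt : ∀ v : H, ∃ C, ∀ k, ‖innerSL ℂ (u k) v‖ ≤ C := fun v => by
    obtain ⟨C, hC⟩ := (hu v).norm.bddAbove_range
    refine ⟨C, fun k => ?_⟩
    rw [innerSL_apply_apply, norm_inner_symm]
    exact hC ⟨k, rfl⟩
  obtain ⟨R, hR⟩ := banach_steinhaus hpt
  exact ⟨R, fun k => by simpa only [innerSL_apply_norm] using hR k⟩

theorem exists_forall_norm_le_of_continuousOn_Ici {φ : ℝ → ℝ} (hφ : ContinuousOn φ (Set.Ici 0))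
    (R : ℝ) : ∃ C : ℝ, ∀ t, 0 ≤ t → t ≤ R → ‖φ t‖ ≤ C := by
  obtain ⟨C, hC⟩ := isCompact_Icc.exists_bound_of_continuousOn
    (hφ.mono (Set.Icc_subset_Ici_self : Set.Icc 0 R ⊆ Set.Ici 0))
  exact ⟨C, fun t h0 hR => hC t ⟨h0, hR⟩⟩

theorem re_inner_le_re_inner_sub {H : Type*} [NormedAddCommGroup H] [InnerProductSpace ℂ H]
    (u u₀ : H) : (inner ℂ u₀ (u - u₀) : ℂ).re ≤ (inner ℂ u (u - u₀) : ℂ).re := by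
  have h : 0 ≤ (inner ℂ (u - u₀) (u - u₀) : ℂ).re := inner_self_nonneg (𝕜 := ℂ)
  rw [inner_sub_left, Complex.sub_re] at h
  linarith

/-- For a continuous `φ : [0, ∞) → [0, ∞)` the operator
`N(u) = φ(‖u‖) P_B(u)` is bounded, continuous and quasi-monotone, and for every sequence with
`‖u_k‖ → +∞` one has `limsup Re⟪N(u_k), u_k⟫/‖u_k‖ = limsup φ(‖u_k‖)`. -/
theorem stmt_11 {H : Type*} [NormedAddCommGroup H] [InnerProductSpace ℂ H] [CompleteSpace H]
    (φ : ℝ → ℝ) (hφc : ContinuousOn φ (Set.Ici 0)) (hφnn : ∀ t : ℝ, 0 ≤ t → 0 ≤ φ t)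
    (N : H → H) (hN : ∀ u : H, N u = ((φ ‖u‖ : ℝ) : ℂ) • ballProjection u) :
    (∀ s : Set H, Bornology.IsBounded s → Bornology.IsBounded (N '' s)) ∧
    Continuous N ∧
    (∀ (u : ℕ → H) (u₀ : H),
      (∀ v : H, Tendsto (fun k => (inner ℂ v (u k) : ℂ)) atTop (𝓝 (inner ℂ v u₀))) →
      (0 : EReal) ≤
        Filter.limsup (fun k => (((inner ℂ (N (u k)) (u k - u₀) : ℂ).re : ℝ) : EReal)) atTop) ∧
    (∀ u : ℕ → H, Tendsto (fun k => ‖u k‖) atTop atTop →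
      Filter.limsup
          (fun k => ((((inner ℂ (N (u k)) (u k) : ℂ).re / ‖u k‖ : ℝ)) : EReal)) atTop =
        Filter.limsup (fun k => ((φ ‖u k‖ : ℝ) : EReal)) atTop) := by
  have hbdd (R : ℝ) := exists_forall_norm_le_of_continuousOn_Ici hφc R
  have hinner (u v : H) : (inner ℂ (N u) v : ℂ).re =
      φ ‖u‖ * (max 1 ‖u‖)⁻¹ * (inner ℂ u v : ℂ).re := by
    rw [hN, ballProjection_eq_smul, inner_smul_left, inner_smul_left, Complex.conj_ofReal,
      Complex.conj_ofReal, Complex.re_ofReal_mul, Complex.re_ofReal_mul, mul_assoc]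
  refine ⟨fun s hs => ?_, ?_, fun u u₀ hu => ?_, fun u hu => ?_⟩
  · obtain ⟨R, hR⟩ := hs.exists_norm_le
    obtain ⟨C, hC⟩ := hbdd R
    refine isBounded_iff_forall_norm_le.mpr ⟨C, ?_⟩
    rintro _ ⟨u, hu, rfl⟩
    rw [hN, norm_smul, Complex.norm_real]
    exact (mul_le_of_le_one_right (norm_nonneg _) (norm_ballProjection_le_one u)).trans
      (hC _ (norm_nonneg u) (hR u hu))
  · rw [funext hN]
    refine Continuous.smul (Complex.continuous_ofReal.comp ?_) continuous_ballProjection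
    exact hφc.comp_continuous continuous_norm fun u => norm_nonneg u
  · obtain ⟨R, hR⟩ := exists_norm_le_of_tendsto_inner hu
    obtain ⟨C, hC⟩ := hbdd R
    have hweak : Tendsto (fun k => (inner ℂ u₀ (u k - u₀) : ℂ).re) atTop (𝓝 0) := by
      have h := (Complex.continuous_re.tendsto _).comp ((hu u₀).sub_const (inner ℂ u₀ u₀))
      simpa [Function.comp_def, inner_sub_right] using h
    have hweight : IsBoundedUnder (· ≤ ·) atTop
        (norm ∘ fun k => φ ‖u k‖ * (max 1 ‖u k‖)⁻¹) := by
      refine isBoundedUnder_of ⟨C, fun k => ?_⟩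
      have hinv : ‖(max 1 ‖u k‖)⁻¹‖ ≤ 1 := by
        rw [Real.norm_of_nonneg (by positivity)]
        exact inv_le_one_of_one_le₀ (le_max_left _ _)
      rw [Function.comp_apply, norm_mul]
      exact (mul_le_of_le_one_right (norm_nonneg _) hinv).trans (hC _ (norm_nonneg _) (hR k))
    have hlim : Tendsto (fun k => ((φ ‖u k‖ * (max 1 ‖u k‖)⁻¹ *
        (inner ℂ u₀ (u k - u₀) : ℂ).re : ℝ) : EReal)) atTop (𝓝 0) :=
      (continuous_coe_real_ereal.tendsto 0).comp
        (isBoundedUnder_le_mul_tendsto_zero hweight hweak)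
    rw [← hlim.limsup_eq]
    refine limsup_le_limsup (Eventually.of_forall fun k => ?_)
    simp only [hinner, EReal.coe_le_coe_iff]
    have := hφnn _ (norm_nonneg (u k))
    exact mul_le_mul_of_nonneg_left (re_inner_le_re_inner_sub _ _) (by positivity)
  · refine limsup_congr ?_
    filter_upwards [hu.eventually_gt_atTop 1] with k hk
    have hself : (inner ℂ (u k) (u k) : ℂ).re = ‖u k‖ ^ 2 := inner_self_eq_norm_sq (𝕜 := ℂ) (u k)
    have hne : ‖u k‖ ≠ 0 := (one_pos.trans hk).ne'
    rw [hinner, hself, max_eq_right hk.le]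
    congr 1
    field_simp
end

section
/- In the finite-dimensional-negative-part setting, let h ∈ H and let φ : [0, ∞) → [0, ∞) be continuous with (i) lim_{t→+∞} φ(t)²/t = 0 and (ii) liminf_{t→+∞} φ(t) > ‖h‖. Define N(u) = φ(‖u‖) P_B(u), where P_B is the metric projection onto the closed unit ball (P_B(u) = u if ‖u‖ ≤ 1, P_B(u) = u/‖u‖ if ‖u‖ > 1). Then the equation Lu + N(u) = h has a solution u ∈ dom L. -/
open Filter Topology

/-- A self-adjoint operator `L` on the domain `dom` which is reduced by `H₁` and `H₁ᗮ` and is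
nonnegative on `H₁ᗮ`; `P₁` is the orthogonal projection onto `H₁`. -/
structure IsReducedSelfAdjoint {H : Type*} [NormedAddCommGroup H] [InnerProductSpace ℂ H]
    (H₁ dom : Submodule ℂ H) (P₁ L : H → H) : Prop where
  le_dom : H₁ ≤ dom
  proj_mem : ∀ u : H, P₁ u ∈ H₁
  sub_proj_mem : ∀ u : H, u - P₁ u ∈ H₁ᗮ
  lin : ∀ u ∈ dom, ∀ v ∈ dom, ∀ a b : ℂ, L (a • u + b • v) = a • L u + b • L v
  symm : ∀ u ∈ dom, ∀ v ∈ dom, (inner ℂ (L u) v : ℂ) = inner ℂ u (L v)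
  selfadj : ∀ v w : H, (∀ u ∈ dom, (inner ℂ v (L u) : ℂ) = inner ℂ w u) → v ∈ dom ∧ L v = w
  map_mem : ∀ u ∈ H₁, L u ∈ H₁
  map_mem_orth : ∀ u ∈ dom, u ∈ H₁ᗮ → L u ∈ H₁ᗮ
  nonneg : ∀ u ∈ dom, u ∈ H₁ᗮ → 0 ≤ (inner ℂ (L u) u : ℂ).re

namespace IsReducedSelfAdjoint

variable {H : Type*} [NormedAddCommGroup H] [InnerProductSpace ℂ H]
  {H₁ dom : Submodule ℂ H} {P₁ L : H → H}

lemma map_add (hL : IsReducedSelfAdjoint H₁ dom P₁ L) {u v : H} (hu : u ∈ dom) (hv : v ∈ dom) :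
    L (u + v) = L u + L v := by
  simpa using hL.lin u hu v hv 1 1

lemma map_smul (hL : IsReducedSelfAdjoint H₁ dom P₁ L) {u : H} (hu : u ∈ dom) (a : ℂ) :
    L (a • u) = a • L u := by
  simpa using hL.lin u hu u hu a 0

lemma map_sub (hL : IsReducedSelfAdjoint H₁ dom P₁ L) {u v : H} (hu : u ∈ dom) (hv : v ∈ dom) :
    L (u - v) = L u - L v := by
  simpa [sub_eq_add_neg] using hL.lin u hu v hv 1 (-1)

/-- The graph of `L` is closed under weak limits. -/
lemma mem_graph_of_tendsto (hL : IsReducedSelfAdjoint H₁ dom P₁ L) {ι : Type*} {F : Filter ι}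
    [F.NeBot] {x y : ι → H} {u g : H} (hx : ∀ᶠ i in F, x i ∈ dom ∧ L (x i) = y i)
    (hxu : ∀ v, Tendsto (fun i => (inner ℂ (x i) v : ℂ)) F (𝓝 (inner ℂ u v)))
    (hyg : ∀ v, Tendsto (fun i => (inner ℂ (y i) v : ℂ)) F (𝓝 (inner ℂ g v))) :
    u ∈ dom ∧ L u = g := by
  refine hL.selfadj u g fun v hv => ?_
  refine tendsto_nhds_unique (hxu (L v)) ((hyg v).congr' ?_)
  filter_upwards [hx] with i hi
  rw [← hi.2, hL.symm _ hi.1 _ hv]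

/-- A shift of `L` that is bounded below is onto. -/
lemma surjective_of_bounded_below [CompleteSpace H] (hL : IsReducedSelfAdjoint H₁ dom P₁ L)
    {c l : ℝ} (hc : 0 < c) (hb : ∀ u ∈ dom, c * ‖u‖ ≤ ‖L u + (l : ℂ) • u‖) (f : H) :
    ∃ u ∈ dom, L u + (l : ℂ) • u = f := by
  let R : Submodule ℂ H :=
    { carrier := {f | ∃ u ∈ dom, L u + (l : ℂ) • u = f}
      add_mem' := by
        rintro _ _ ⟨u, hu, rfl⟩ ⟨v, hv, rfl⟩
        refine ⟨u + v, dom.add_mem hu hv, ?_⟩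
        rw [hL.map_add hu hv, smul_add]; abel
      zero_mem' := ⟨0, dom.zero_mem, by simpa using hL.map_smul dom.zero_mem 0⟩
      smul_mem' := by
        rintro a _ ⟨u, hu, rfl⟩
        refine ⟨a • u, dom.smul_mem a hu, ?_⟩
        rw [hL.map_smul hu, smul_add, smul_comm] }
  have hRc : IsClosed (R : Set H) := by
    refine isClosed_of_closure_subset fun f hf => ?_
    obtain ⟨y, hy, hyf⟩ := mem_closure_iff_seq_limit.1 hf
    choose x hxd hxy using hy
    have hcau : CauchySeq x := by
      rw [Metric.cauchySeq_iff]
      intro ε hε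
      obtain ⟨N, hN⟩ := Metric.cauchySeq_iff.1 hyf.cauchySeq (c * ε) (by positivity)
      refine ⟨N, fun m hm n hn => ?_⟩
      have h1 := hb _ (dom.sub_mem (hxd m) (hxd n))
      have h2 : L (x m - x n) + (l : ℂ) • (x m - x n) = y m - y n := by
        rw [hL.map_sub (hxd m) (hxd n), ← hxy m, ← hxy n, smul_sub]; abel
      have h3 := hN m hm n hn
      rw [dist_eq_norm] at h3 ⊢
      rw [h2] at h1
      exact lt_of_mul_lt_mul_left (h1.trans_lt h3) hc.le
    obtain ⟨u, hu⟩ := cauchySeq_tendsto_of_complete hcau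
    obtain ⟨hud, hLu⟩ := hL.mem_graph_of_tendsto (F := atTop) (x := x)
      (y := fun n => y n - (l : ℂ) • x n) (u := u) (g := f - (l : ℂ) • u)
      (Eventually.of_forall fun n => ⟨hxd n, by rw [← hxy n]; abel⟩)
      (fun v => hu.inner tendsto_const_nhds)
      (fun v => (hyf.sub (hu.const_smul _)).inner tendsto_const_nhds)
    exact ⟨u, hud, by rw [hLu]; abel⟩
  have hRo : Rᗮ = ⊥ := by
    rw [Submodule.eq_bot_iff]
    intro v hv
    have hv' : ∀ u ∈ dom, (inner ℂ v (L u) : ℂ) = inner ℂ (-((l : ℂ) • v)) u := by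
      intro u hu
      have h1 := (Submodule.mem_orthogonal' R v).1 hv _ ⟨u, hu, rfl⟩
      rw [inner_add_right, inner_smul_right] at h1
      rw [inner_neg_left, inner_smul_left, Complex.conj_ofReal]
      exact eq_neg_of_add_eq_zero_left h1
    obtain ⟨hvd, hLv⟩ := hL.selfadj _ _ hv'
    have h1 := hb v hvd
    rw [hLv, neg_add_cancel, norm_zero] at h1
    exact norm_le_zero_iff.1 (by nlinarith)
  have : CompleteSpace R := hRc.completeSpace_coe
  have hRt : R = ⊤ := Submodule.orthogonal_eq_bot_iff.1 hRo
  have : f ∈ R := hRt ▸ Submodule.mem_top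
  exact this

lemma norm_sq_eq (hL : IsReducedSelfAdjoint H₁ dom P₁ L) (u : H) :
    ‖u‖ ^ 2 = ‖P₁ u‖ ^ 2 + ‖u - P₁ u‖ ^ 2 := by
  have h1 := norm_add_sq_eq_norm_sq_add_norm_sq_of_inner_eq_zero (𝕜 := ℂ) (P₁ u) (u - P₁ u)
    (Submodule.inner_right_of_mem_orthogonal (hL.proj_mem u) (hL.sub_proj_mem u))
  rw [add_sub_cancel] at h1
  nlinarith

lemma proj_mem_dom (hL : IsReducedSelfAdjoint H₁ dom P₁ L) (u : H) : P₁ u ∈ dom :=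
  hL.le_dom (hL.proj_mem u)

lemma sub_proj_mem_dom (hL : IsReducedSelfAdjoint H₁ dom P₁ L) {u : H} (hu : u ∈ dom) :
    u - P₁ u ∈ dom :=
  dom.sub_mem hu (hL.proj_mem_dom u)

/-- A shifted equation splits into its components in `H₁` and `H₁ᗮ`. -/
lemma split_eq (hL : IsReducedSelfAdjoint H₁ dom P₁ L) {u f : H} {l : ℂ} (hu : u ∈ dom)
    (hf : L u + l • u = f) :
    L (P₁ u) + l • P₁ u = P₁ f ∧ L (u - P₁ u) + l • (u - P₁ u) = f - P₁ f := by
  have h1 : L (P₁ u) + l • P₁ u ∈ H₁ :=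
    H₁.add_mem (hL.map_mem _ (hL.proj_mem u)) (H₁.smul_mem _ (hL.proj_mem u))
  have h2 : L (u - P₁ u) + l • (u - P₁ u) ∈ H₁ᗮ :=
    H₁ᗮ.add_mem (hL.map_mem_orth _ (hL.sub_proj_mem_dom hu) (hL.sub_proj_mem u))
      (H₁ᗮ.smul_mem _ (hL.sub_proj_mem u))
  have h3 : (L (P₁ u) + l • P₁ u) - P₁ f
      = (f - P₁ f) - (L (u - P₁ u) + l • (u - P₁ u)) := by
    rw [hL.map_sub hu (hL.proj_mem_dom u), ← hf, smul_sub]; abel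
  have h4 : (L (P₁ u) + l • P₁ u) - P₁ f = 0 := by
    have h5 : (L (P₁ u) + l • P₁ u) - P₁ f ∈ H₁ᗮ := by
      rw [h3]; exact H₁ᗮ.sub_mem (hL.sub_proj_mem f) h2
    exact Submodule.disjoint_def.1 H₁.orthogonal_disjoint _
      (H₁.sub_mem h1 (hL.proj_mem f)) h5
  exact ⟨sub_eq_zero.1 h4, (sub_eq_zero.1 (h3.symm.trans h4)).symm⟩

lemma bounded_below_orth (hL : IsReducedSelfAdjoint H₁ dom P₁ L) {l : ℝ} {u : H}
    (hu : u ∈ dom) (hu' : u ∈ H₁ᗮ) : l * ‖u‖ ≤ ‖L u + (l : ℂ) • u‖ := by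
  have h1 := hL.nonneg u hu hu'
  have h2 : (inner ℂ (L u + (l : ℂ) • u) u : ℂ).re
      = (inner ℂ (L u) u : ℂ).re + l * ‖u‖ ^ 2 := by
    rw [inner_add_left, inner_smul_left, Complex.conj_ofReal, Complex.add_re,
      inner_self_eq_norm_sq_to_K, Complex.re_ofReal_mul]
    norm_cast
  have h3 := re_inner_le_norm (𝕜 := ℂ) (L u + (l : ℂ) • u) u
  rw [RCLike.re_eq_complex_re, h2] at h3
  rcases (norm_nonneg u).eq_or_lt with h0 | h0
  · rw [← h0]; simp
  · nlinarith

lemma bounded_below (hL : IsReducedSelfAdjoint H₁ dom P₁ L) {c l : ℝ} (hc : 0 < c) (hl : 0 < l)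
    (hb : ∀ u ∈ H₁, c * ‖u‖ ≤ ‖L u + (l : ℂ) • u‖) :
    ∀ u ∈ dom, min c l * ‖u‖ ≤ ‖L u + (l : ℂ) • u‖ := by
  intro u hu
  obtain ⟨h1, h2⟩ := hL.split_eq hu (rfl : L u + (l : ℂ) • u = _)
  have h3 := hb _ (hL.proj_mem u)
  have h4 := hL.bounded_below_orth (l := l) (hL.sub_proj_mem_dom hu) (hL.sub_proj_mem u)
  rw [h1] at h3
  rw [h2] at h4
  have hm : 0 < min c l := lt_min hc hl
  have h3' := pow_le_pow_left₀ (by positivity)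
    ((mul_le_mul_of_nonneg_right (min_le_left c l) (norm_nonneg _)).trans h3) 2
  have h4' := pow_le_pow_left₀ (by positivity)
    ((mul_le_mul_of_nonneg_right (min_le_right c l) (norm_nonneg _)).trans h4) 2
  refine le_of_sq_le_sq ?_ (norm_nonneg _)
  rw [hL.norm_sq_eq (L u + (l : ℂ) • u), mul_pow, hL.norm_sq_eq u]
  rw [mul_pow] at h3' h4'
  linarith

lemma exists_bounded_below_of_injective [FiniteDimensional ℂ H₁]
    (hL : IsReducedSelfAdjoint H₁ dom P₁ L) {l : ℂ}
    (hinj : ∀ u ∈ H₁, L u + l • u = 0 → u = 0) :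
    ∃ c > 0, ∀ u ∈ H₁, c * ‖u‖ ≤ ‖L u + l • u‖ := by
  let T : H₁ →ₗ[ℂ] H :=
    { toFun := fun u => L u + l • (u : H)
      map_add' := fun u v => by
        rw [Submodule.coe_add, hL.map_add (hL.le_dom u.2) (hL.le_dom v.2), smul_add]; abel
      map_smul' := fun a u => by
        rw [Submodule.coe_smul, hL.map_smul (hL.le_dom u.2), RingHom.id_apply, smul_add,
          smul_comm] }
  have hT : LinearMap.ker T = ⊥ := LinearMap.ker_eq_bot'.2 fun u hu =>
    Subtype.ext (hinj u u.2 hu)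
  obtain ⟨K, hK, hKT⟩ := T.exists_antilipschitzWith hT
  refine ⟨(K : ℝ)⁻¹, by positivity, fun u hu => ?_⟩
  have h1 := hKT.le_mul_dist ⟨u, hu⟩ 0
  rw [map_zero, dist_zero_right, dist_zero_right] at h1
  rw [inv_mul_le_iff₀ (by positivity)]
  exact h1

/-- If `u` solves the equation shifted by `s ≥ 0` and the solution is unique, then the equations
with nearby shifts `l ≥ 0` have solutions of norm not much larger than `‖u‖`. -/
lemma exists_solution_near [CompleteSpace H] [FiniteDimensional ℂ H₁]
    (hL : IsReducedSelfAdjoint H₁ dom P₁ L) {s : ℝ} (hs : 0 ≤ s)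
    (hinj : ∀ u ∈ H₁, L u + (s : ℂ) • u = 0 → u = 0) {u h : H} (hu : u ∈ dom)
    (huh : L u + (s : ℂ) • u = h) {K : ℝ} (hK : 1 < K) :
    ∃ η > 0, ∀ l : ℝ, 0 ≤ l → |l - s| < η →
      ∃ w ∈ dom, L w + (l : ℂ) • w = h ∧ ‖w‖ ≤ K * ‖u‖ := by
  obtain ⟨c, hc, hcb⟩ := hL.exists_bounded_below_of_injective hinj
  have key : ∀ l : ℝ, 0 < l → |l - s| ≤ c / 2 → |l - s| ≤ (K - 1) * (c / 2) → s ≤ K * l →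
      ∃ w ∈ dom, L w + (l : ℂ) • w = h ∧ ‖w‖ ≤ K * ‖u‖ := by
    intro l hl hl1 hl2 hl3
    have hb : ∀ v ∈ H₁, c / 2 * ‖v‖ ≤ ‖L v + (l : ℂ) • v‖ := by
      intro v hv
      have h1 := hcb v hv
      have h2 : L v + (s : ℂ) • v = (L v + (l : ℂ) • v) - ((l - s : ℝ) : ℂ) • v := by
        push_cast; rw [sub_smul]; abel
      have h3 := norm_sub_le (L v + (l : ℂ) • v) (((l - s : ℝ) : ℂ) • v)
      rw [← h2, norm_smul, Complex.norm_real, Real.norm_eq_abs] at h3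
      nlinarith [mul_le_mul_of_nonneg_right hl1 (norm_nonneg v)]
    obtain ⟨w, hw, hwh⟩ := hL.surjective_of_bounded_below (lt_min (half_pos hc) hl)
      (hL.bounded_below (half_pos hc) hl hb) h
    refine ⟨w, hw, hwh, ?_⟩
    obtain ⟨hu1, hu2⟩ := hL.split_eq hu huh
    obtain ⟨hw1, hw2⟩ := hL.split_eq hw hwh
    have hdiff : ∀ a b : H, a ∈ dom → b ∈ dom → L a + (s : ℂ) • a = L b + (l : ℂ) • b →
        L (b - a) + (l : ℂ) • (b - a) = -(((l - s : ℝ) : ℂ) • a) := by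
      intro a b ha hb hab
      have : L b = L a + (s : ℂ) • a - (l : ℂ) • b := by rw [hab]; abel
      rw [hL.map_sub hb ha, this]; push_cast; module
    have e1 : ‖P₁ w‖ ≤ K * ‖P₁ u‖ := by
      have h1 := hb _ (H₁.sub_mem (hL.proj_mem w) (hL.proj_mem u))
      rw [hdiff _ _ (hL.proj_mem_dom u) (hL.proj_mem_dom w) (hu1.trans hw1.symm), norm_neg,
        norm_smul, Complex.norm_real, Real.norm_eq_abs] at h1
      have h2 : ‖P₁ w - P₁ u‖ ≤ (K - 1) * ‖P₁ u‖ := by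
        have := mul_le_mul_of_nonneg_right hl2 (norm_nonneg (P₁ u))
        refine le_of_mul_le_mul_left ?_ (half_pos hc)
        linarith
      have h3 := norm_sub_norm_le (P₁ w) (P₁ u)
      linarith
    have e2 : ‖w - P₁ w‖ ≤ K * ‖u - P₁ u‖ := by
      have had := hL.sub_proj_mem_dom hu
      have hbd := hL.sub_proj_mem_dom hw
      have hao := hL.sub_proj_mem u
      have hbo := hL.sub_proj_mem w
      have hab := hu2.trans hw2.symm
      generalize u - P₁ u = a at *
      generalize w - P₁ w = b at *
      have hd := hdiff a b had hbd hab
      rcases le_or_gt l s with hls | hls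
      · have h1 := hL.bounded_below_orth (l := l) (dom.sub_mem hbd had) (H₁ᗮ.sub_mem hbo hao)
        rw [hd, norm_neg, norm_smul, Complex.norm_real, Real.norm_eq_abs, abs_of_nonpos
          (by linarith)] at h1
        have h3 := norm_sub_norm_le b a
        have h4 := mul_le_mul_of_nonneg_right hl3 (norm_nonneg a)
        refine le_of_mul_le_mul_left ?_ hl
        nlinarith
      · have h1 := hL.nonneg _ (dom.sub_mem hbd had) (H₁ᗮ.sub_mem hbo hao)
        have h2 : L (b - a) = -(((l - s : ℝ) : ℂ) • b) - (s : ℂ) • (b - a) := by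
          rw [eq_sub_of_add_eq hd]; push_cast; module
        have h3 : (inner ℂ (L (b - a)) (b - a) : ℂ).re
            = -((l - s) * (‖b‖ ^ 2 - (inner ℂ b a : ℂ).re)) - s * ‖b - a‖ ^ 2 := by
          rw [h2, inner_sub_left, inner_neg_left, inner_smul_left, inner_smul_left,
            Complex.conj_ofReal, Complex.conj_ofReal, Complex.sub_re, Complex.neg_re,
            Complex.re_ofReal_mul, Complex.re_ofReal_mul, inner_self_eq_norm_sq_to_K,
            inner_sub_right, Complex.sub_re, inner_self_eq_norm_sq_to_K]
          norm_cast
        have h4 : ‖b‖ ^ 2 ≤ (inner ℂ b a : ℂ).re := by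
          have : 0 ≤ s * ‖b - a‖ ^ 2 := by positivity
          rw [h3] at h1
          nlinarith
        have h5 : (inner ℂ b a : ℂ).re ≤ ‖b‖ * ‖a‖ := re_inner_le_norm (𝕜 := ℂ) b a
        have h6 : ‖b‖ ≤ ‖a‖ := by
          rcases (norm_nonneg b).eq_or_lt with h0 | h0
          · rw [← h0]; positivity
          · nlinarith
        nlinarith [norm_nonneg a]
    refine le_of_sq_le_sq ?_ (by positivity)
    rw [hL.norm_sq_eq w, mul_pow, hL.norm_sq_eq u]
    have := pow_le_pow_left₀ (norm_nonneg _) e1 2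
    have := pow_le_pow_left₀ (norm_nonneg _) e2 2
    rw [mul_pow] at *
    linarith
  have hK1 : 0 < K - 1 := by linarith
  rcases hs.eq_or_lt with hs0 | hs0
  · refine ⟨min (c / 2) ((K - 1) * (c / 2)), by positivity, fun l hl hlη => ?_⟩
    rcases hl.eq_or_lt with hl0 | hl0
    · refine ⟨u, hu, by rw [← hl0, hs0, huh], ?_⟩
      nlinarith [norm_nonneg u]
    · exact key l hl0 (hlη.le.trans (min_le_left _ _)) (hlη.le.trans (min_le_right _ _))
        (by rw [← hs0]; positivity)
  · refine ⟨min (min (c / 2) ((K - 1) * (c / 2))) (s * (K - 1) / K), by positivity,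
      fun l hl hlη => ?_⟩
    rw [lt_min_iff, lt_min_iff] at hlη
    have h1 : K * (s - l) < s * (K - 1) := by
      have h2 := (neg_le_abs (l - s)).trans_lt hlη.2
      rw [lt_div_iff₀ (by positivity)] at h2
      nlinarith
    have h2 : s < K * l := by linarith
    exact key l (by nlinarith) hlη.1.1.le hlη.1.2.le h2.le

/-- Solutions with norm at most the parameter survive in the limit. -/
lemma exists_solution_of_mem_closure [CompleteSpace H] (hL : IsReducedSelfAdjoint H₁ dom P₁ L)
    {h : H} {ψ : ℝ → ℝ} {S : Set ℝ} {r : ℝ} (hψ : ContinuousWithinAt ψ S r)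
    (hS : ∀ t ∈ S, ∃ u ∈ dom, L u + (ψ t : ℂ) • u = h ∧ ‖u‖ ≤ t) (hr : r ∈ closure S) :
    ∃ u ∈ dom, L u + (ψ r : ℂ) • u = h ∧ ‖u‖ ≤ r := by
  choose! x hxd hxh hxr using hS
  have : (𝓝[S] r).NeBot := mem_closure_iff_nhdsWithin_neBot.1 hr
  let U : Ultrafilter ℝ := Ultrafilter.of (𝓝[S] r)
  have hU : (U : Filter ℝ) ≤ 𝓝[S] r := Ultrafilter.of_le _
  have hUS : ∀ᶠ t in (U : Filter ℝ), t ∈ S := hU self_mem_nhdsWithin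
  have hUr : Tendsto (fun t : ℝ => t) U (𝓝 r) := hU.trans nhdsWithin_le_nhds
  have hUψ : Tendsto ψ U (𝓝 (ψ r)) := hψ.mono_left hU
  let F : ℝ → WeakDual ℂ H := fun t => StrongDual.toWeakDual (InnerProductSpace.toDual ℂ H (x t))
  have hcomp : IsCompact
      (WeakDual.toStrongDual ⁻¹' Metric.closedBall (0 : StrongDual ℂ H) (r + 1)) :=
    WeakDual.isCompact_closedBall 0 (r + 1)
  obtain ⟨f, -, hf⟩ := hcomp.ultrafilter_le_nhds (U.map F) (by
    rw [Ultrafilter.coe_map, le_principal_iff, mem_map]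
    filter_upwards [hUS, hUr.eventually_lt_const (lt_add_one r)] with t ht htr
    have : ‖InnerProductSpace.toDual ℂ H (x t)‖ ≤ r + 1 := by
      rw [LinearIsometryEquiv.norm_map]; exact (hxr t ht).trans htr.le
    simpa [F] using this)
  obtain ⟨u, hu⟩ := (InnerProductSpace.toDual ℂ H).surjective (WeakDual.toStrongDual f)
  have hxu : ∀ v, Tendsto (fun t => (inner ℂ (x t) v : ℂ)) U (𝓝 (inner ℂ u v)) := by
    intro v
    have h1 : Tendsto (fun t => F t v) U (𝓝 (f v)) :=
      ((WeakDual.eval_continuous v).tendsto f).comp hf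
    have h2 : f v = inner ℂ u v := by
      rw [← InnerProductSpace.toDual_apply_apply, hu]; rfl
    rw [h2] at h1
    exact h1
  obtain ⟨hud, hLu⟩ := hL.mem_graph_of_tendsto (F := (U : Filter ℝ)) (x := x)
    (y := fun t => h - (ψ t : ℂ) • x t) (u := u) (g := h - (ψ r : ℂ) • u)
    (hUS.mono fun t ht => ⟨hxd t ht, by rw [← hxh t ht]; abel⟩) hxu
    (fun v => by
      simp only [inner_sub_left, inner_smul_left, Complex.conj_ofReal]
      exact tendsto_const_nhds.sub (((Complex.continuous_ofReal.tendsto _).comp hUψ).mul (hxu v)))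
  refine ⟨u, hud, by rw [hLu]; abel, ?_⟩
  have h1 : ‖u‖ ^ 2 ≤ r * ‖u‖ := by
    have h2 := (Complex.continuous_re.tendsto _).comp (hxu u)
    rw [inner_self_eq_norm_sq_to_K] at h2
    have h3 := le_of_tendsto_of_tendsto h2 (hUr.mul_const ‖u‖) (by
      filter_upwards [hUS] with t ht
      exact (re_inner_le_norm (𝕜 := ℂ) (x t) u).trans
        (mul_le_mul_of_nonneg_right (hxr t ht) (norm_nonneg u)))
    have h4 : (((‖u‖ : ℝ) : ℂ) ^ 2).re = ‖u‖ ^ 2 := by norm_cast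
    exact h4 ▸ h3
  have hr0 : 0 ≤ r := ge_of_tendsto hUr (hUS.mono fun t ht => (norm_nonneg _).trans (hxr t ht))
  rcases (norm_nonneg u).eq_or_lt with h0 | h0
  · rw [← h0]; exact hr0
  · nlinarith

/-- A resonant equation with a solution of norm at most `r` has one of norm exactly `r`. -/
lemma exists_solution_norm_eq (hL : IsReducedSelfAdjoint H₁ dom P₁ L) {u k h : H} {l : ℂ} {r : ℝ}
    (hu : u ∈ dom) (huh : L u + l • u = h) (hur : ‖u‖ ≤ r) (hk : k ∈ dom) (hk0 : k ≠ 0)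
    (hkl : L k + l • k = 0) : ∃ w ∈ dom, L w + l • w = h ∧ ‖w‖ = r := by
  have hk' : 0 < ‖k‖ := norm_pos_iff.2 hk0
  have hr : 0 ≤ r := (norm_nonneg u).trans hur
  have hcont : Continuous fun t : ℝ => ‖u + (t : ℂ) • k‖ := by fun_prop
  have hT : 0 ≤ (r + ‖u‖) / ‖k‖ := by positivity
  obtain ⟨t, -, ht⟩ := intermediate_value_Icc hT hcont.continuousOn (show r ∈ Set.Icc _ _ from
    ⟨by simpa using hur, by
      have h1 := norm_sub_norm_le ((((r + ‖u‖) / ‖k‖ : ℝ) : ℂ) • k) (-u)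
      rw [norm_neg, norm_smul, Complex.norm_real, Real.norm_of_nonneg hT,
        div_mul_cancel₀ _ hk'.ne', sub_neg_eq_add, add_comm _ u] at h1
      linarith⟩)
  refine ⟨u + (t : ℂ) • k, dom.add_mem hu (dom.smul_mem _ hk), ?_, ht⟩
  rw [hL.map_add hu (dom.smul_mem _ hk), hL.map_smul hk, eq_neg_of_add_eq_zero_left hkl, ← huh]
  module

/-- If some parameter `R` has a solution of norm at most `R`, then a suitable parameter has
one whose norm is equal to it. -/
theorem exists_solution_norm_eq_param [CompleteSpace H] [FiniteDimensional ℂ H₁]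
    (hL : IsReducedSelfAdjoint H₁ dom P₁ L) {h : H} {ψ : ℝ → ℝ}
    (hψ : ContinuousOn ψ (Set.Ici 0)) (hψ0 : ∀ t, 0 ≤ t → 0 ≤ ψ t) {R : ℝ}
    (hR : ∃ u ∈ dom, L u + (ψ R : ℂ) • u = h ∧ ‖u‖ ≤ R) :
    ∃ u ∈ dom, L u + (ψ ‖u‖ : ℂ) • u = h := by
  let S : Set ℝ := {t | ∃ u ∈ dom, L u + (ψ t : ℂ) • u = h ∧ ‖u‖ ≤ t}
  have hS0 : ∀ t ∈ S, 0 ≤ t := fun t ⟨u, _, _, hut⟩ => (norm_nonneg u).trans hut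
  have hSb : BddBelow S := ⟨0, hS0⟩
  have hSne : S.Nonempty := ⟨R, hR⟩
  have hr0 : 0 ≤ sInf S := le_csInf hSne hS0
  obtain ⟨u, hu, huh, hur⟩ := hL.exists_solution_of_mem_closure
    ((hψ _ hr0).mono hS0) (fun t ht => ht) (csInf_mem_closure hSne hSb)
  generalize hr : sInf S = r at *
  by_cases hker : ∃ k ∈ dom, k ≠ 0 ∧ L k + (ψ r : ℂ) • k = 0
  · obtain ⟨k, hk, hk0, hkl⟩ := hker
    obtain ⟨w, hw, hwh, hwr⟩ := hL.exists_solution_norm_eq hu huh hur hk hk0 hkl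
    exact ⟨w, hw, by rw [hwr, hwh]⟩
  rcases hur.eq_or_lt with hur | hur
  · exact ⟨u, hu, by rw [hur, huh]⟩
  exfalso
  have hrpos : 0 < r := (norm_nonneg u).trans_lt hur
  obtain ⟨K, hK, hKu⟩ : ∃ K > 1, K * ‖u‖ < r := by
    rcases (norm_nonneg u).eq_or_lt with h0 | h0
    · exact ⟨2, by norm_num, by rw [← h0]; simpa using hrpos⟩
    · obtain ⟨m, hm1, hm2⟩ := exists_between hur
      exact ⟨m / ‖u‖, (one_lt_div h0).2 hm1, by rwa [div_mul_cancel₀ _ h0.ne']⟩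
  obtain ⟨η, hη, hsol⟩ := hL.exists_solution_near (hψ0 r hr0)
    (fun k hk hkl => by_contra fun hk0 => hker ⟨k, hL.le_dom hk, hk0, hkl⟩) hu huh hK
  have hcont : Tendsto ψ (𝓝[<] r) (𝓝 (ψ r)) :=
    (hψ.continuousAt (Ici_mem_nhds hrpos)).mono_left nhdsWithin_le_nhds
  have hev : ∀ᶠ t in 𝓝[<] r, |ψ t - ψ r| < η := by
    simpa [Real.dist_eq] using hcont.eventually (Metric.ball_mem_nhds (ψ r) hη)
  obtain ⟨t, htη, htr, htK, ht0⟩ := (hev.and (eventually_mem_nhdsWithin.and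
    ((eventually_nhdsWithin_of_eventually_nhds (lt_mem_nhds hKu)).and
      (eventually_nhdsWithin_of_eventually_nhds (lt_mem_nhds hrpos))))).exists
  obtain ⟨w, hw, hwh, hwu⟩ := hsol (ψ t) (hψ0 t ht0.le) htη
  have htS : t ∈ S := ⟨w, hw, hwh, hwu.trans htK.le⟩
  have := csInf_le hSb htS
  rw [hr] at this
  exact absurd htr (not_lt.2 this)

/-- A small positive shift gives a solution with explicit control of its norm. -/
lemma exists_solution_small_shift [CompleteSpace H] (hL : IsReducedSelfAdjoint H₁ dom P₁ L)
    {δ : ℝ} (hδ : 0 < δ) (hlow : ∀ u ∈ H₁, δ * ‖u‖ ≤ ‖L u‖) (h : H) {l : ℝ} (hl : 0 < l)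
    (hlδ : l ≤ δ / 2) :
    ∃ u ∈ dom, L u + (l : ℂ) • u = h ∧ ‖u‖ ^ 2 ≤ (2 * ‖h‖ / δ) ^ 2 + (‖h‖ / l) ^ 2 := by
  have hb : ∀ v ∈ H₁, δ / 2 * ‖v‖ ≤ ‖L v + (l : ℂ) • v‖ := by
    intro v hv
    have h1 := norm_sub_norm_le (L v) (-((l : ℂ) • v))
    rw [norm_neg, norm_smul, Complex.norm_real, Real.norm_of_nonneg hl.le, sub_neg_eq_add] at h1
    nlinarith [hlow v hv, mul_le_mul_of_nonneg_right hlδ (norm_nonneg v)]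
  obtain ⟨u, hu, huh⟩ := hL.surjective_of_bounded_below (lt_min (half_pos hδ) hl)
    (hL.bounded_below (half_pos hδ) hl hb) h
  refine ⟨u, hu, huh, ?_⟩
  obtain ⟨h1, h2⟩ := hL.split_eq hu huh
  have hh := hL.norm_sq_eq h
  have e1 : ‖P₁ u‖ ≤ 2 * ‖h‖ / δ := by
    have h3 := hb _ (hL.proj_mem u)
    rw [h1] at h3
    have h4 : ‖P₁ h‖ ≤ ‖h‖ := le_of_sq_le_sq (by nlinarith [sq_nonneg ‖h - P₁ h‖]) (norm_nonneg h)
    rw [le_div_iff₀ hδ]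
    linarith
  have e2 : ‖u - P₁ u‖ ≤ ‖h‖ / l := by
    have h3 := hL.bounded_below_orth (l := l) (hL.sub_proj_mem_dom hu) (hL.sub_proj_mem u)
    rw [h2] at h3
    have h4 : ‖h - P₁ h‖ ≤ ‖h‖ := le_of_sq_le_sq (by nlinarith [sq_nonneg ‖P₁ h‖]) (norm_nonneg h)
    rw [le_div_iff₀ hl]
    linarith
  rw [hL.norm_sq_eq u]
  exact add_le_add (pow_le_pow_left₀ (norm_nonneg _) e1 2) (pow_le_pow_left₀ (norm_nonneg _) e2 2)

end IsReducedSelfAdjoint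

lemma smul_ballProjection {H : Type*} [NormedAddCommGroup H] [InnerProductSpace ℂ H] (u : H)
    (a : ℝ) : (a : ℂ) • ballProjection u = ((a / max 1 ‖u‖ : ℝ) : ℂ) • u := by
  unfold ballProjection
  split_ifs with hu
  · rw [max_eq_left hu, div_one]
  · rw [max_eq_right (not_le.1 hu).le, smul_smul, div_eq_mul_inv, Complex.ofReal_mul]

/-- (Finite-dimensional-negative-part setting.) For continuous
`φ : [0, ∞) → [0, ∞)` with `φ(t)²/t → 0` and `liminf_{t→∞} φ(t) > ‖h‖`, the equation
`Lu + φ(‖u‖) P_B(u) = h` has a solution in `dom L`. -/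
theorem stmt_12 {H : Type*} [NormedAddCommGroup H] [InnerProductSpace ℂ H] [CompleteSpace H]
    [TopologicalSpace.SeparableSpace H]
    (H₁ dom : Submodule ℂ H) (hfd : FiniteDimensional ℂ H₁)
    (hdense : Dense (dom : Set H)) (hH₁dom : H₁ ≤ dom)
    (P₁ : H → H) (hP₁mem : ∀ u : H, P₁ u ∈ H₁) (hP₁orth : ∀ u : H, u - P₁ u ∈ H₁ᗮ)
    (L : H → H)
    (hlin : ∀ u ∈ dom, ∀ v ∈ dom, ∀ a b : ℂ, L (a • u + b • v) = a • L u + b • L v)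
    (hsymm : ∀ u ∈ dom, ∀ v ∈ dom, (inner ℂ (L u) v : ℂ) = inner ℂ u (L v))
    (hselfadj : ∀ v w : H, (∀ u ∈ dom, (inner ℂ v (L u) : ℂ) = inner ℂ w u) → v ∈ dom ∧ L v = w)
    (hinv₁ : ∀ u ∈ H₁, L u ∈ H₁)
    (hinv₂ : ∀ u ∈ dom, u ∈ H₁ᗮ → L u ∈ H₁ᗮ)
    (γ δ : ℝ) (hδ : 0 < δ) (hγδ : δ ≤ γ)
    (hlow : ∀ u ∈ H₁, δ * ‖u‖ ≤ ‖L u‖)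
    (hcoer₁ : ∀ u ∈ H₁, -γ * ‖u‖ ^ 2 ≤ (inner ℂ (L u) u : ℂ).re)
    (hnn₂ : ∀ u ∈ dom, u ∈ H₁ᗮ → 0 ≤ (inner ℂ (L u) u : ℂ).re)
    (h : H)
    (φ : ℝ → ℝ) (hφc : ContinuousOn φ (Set.Ici 0)) (hφnn : ∀ t : ℝ, 0 ≤ t → 0 ≤ φ t)
    (hφi : Tendsto (fun t : ℝ => φ t ^ 2 / t) atTop (𝓝 (0 : ℝ)))
    (hφii : ((‖h‖ : ℝ) : EReal) < Filter.liminf (fun t : ℝ => ((φ t : ℝ) : EReal)) atTop) :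
    ∃ u ∈ dom, L u + ((φ ‖u‖ : ℝ) : ℂ) • ballProjection u = h := by
  have hL : IsReducedSelfAdjoint H₁ dom P₁ L :=
    ⟨hH₁dom, hP₁mem, hP₁orth, hlin, hsymm, hselfadj, hinv₁, hinv₂, hnn₂⟩
  simp only [smul_ballProjection]
  obtain ⟨a, ha, ha'⟩ := EReal.lt_iff_exists_real_btwn.1 hφii
  have hha : ‖h‖ < a := EReal.coe_lt_coe_iff.1 ha
  have ha0 : 0 < a := (norm_nonneg h).trans_lt hha
  have hφa : ∀ᶠ t in atTop, a < φ t :=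
    (eventually_lt_of_lt_liminf ha').mono fun t ht => EReal.coe_lt_coe_iff.1 ht
  have hφs : ∀ᶠ t in atTop, φ t ^ 2 / t < a * (δ / 2) :=
    hφi.eventually (gt_mem_nhds (by positivity))
  have hq : 0 < a ^ 2 - ‖h‖ ^ 2 := by nlinarith [norm_nonneg h]
  have hbig : ∀ᶠ t : ℝ in atTop,
      (2 * ‖h‖ / δ) ^ 2 * a ^ 2 / (a ^ 2 - ‖h‖ ^ 2) ≤ t ^ 2 :=
    (tendsto_pow_atTop two_ne_zero).eventually_ge_atTop _
  obtain ⟨R, hRa, hRs, hR1, hRbig⟩ :=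
    (hφa.and (hφs.and ((eventually_ge_atTop 1).and hbig))).exists
  have hR0 : 0 < R := by linarith
  have hφR : 0 < φ R := ha0.trans hRa
  refine hL.exists_solution_norm_eq_param (ψ := fun t => φ t / max 1 t)
    (hφc.div (by fun_prop) fun t _ => by positivity)
    (fun t ht => div_nonneg (hφnn t ht) (by positivity)) (R := R) ?_
  rw [max_eq_right hR1]
  obtain ⟨u, hu, huh, hun⟩ := hL.exists_solution_small_shift hδ hlow h (l := φ R / R)
    (by positivity) (by
      rw [div_le_iff₀ hR0]
      rw [div_lt_iff₀ hR0] at hRs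
      have : a * φ R ≤ φ R ^ 2 := by nlinarith
      refine le_of_mul_le_mul_left ?_ ha0
      linarith)
  refine ⟨u, hu, huh, le_of_sq_le_sq (hun.trans ?_) hR0.le⟩
  have h1 : ‖h‖ / (φ R / R) ≤ ‖h‖ / a * R := by
    rw [div_div_eq_mul_div, div_mul_eq_mul_div]
    gcongr
  have h2 : (‖h‖ / (φ R / R)) ^ 2 ≤ ‖h‖ ^ 2 / a ^ 2 * R ^ 2 := by
    rw [← div_pow, ← mul_pow]
    gcongr
  rw [div_le_iff₀ hq] at hRbig
  have h3 : (2 * ‖h‖ / δ) ^ 2 ≤ R ^ 2 * (a ^ 2 - ‖h‖ ^ 2) / a ^ 2 := by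
    rwa [le_div_iff₀ (by positivity)]
  have h4 : R ^ 2 * (a ^ 2 - ‖h‖ ^ 2) / a ^ 2 + ‖h‖ ^ 2 / a ^ 2 * R ^ 2 = R ^ 2 := by
    field_simp
    ring
  linarith
end

section
/- In the general spectral-gap setting, assume N : H → H is bounded, demicontinuous, N(0) = 0, and there exists α > γ/δ² such that Re⟨N(u) − N(u'), u − u'⟩ ≥ α‖P₁(N(u) − N(u'))‖² for all u, u' ∈ H. Then for every ε > 0 and every h ∈ H the perturbed equation ε P₂u + Lu + N(u) = h admits exactly one solution u ∈ dom L. -/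
open Filter Topology

section MonotoneOperators

variable {H : Type*} [NormedAddCommGroup H] [InnerProductSpace ℂ H]

lemma norm_sub_smul_sq_eq (x g : H) (t : ℝ) :
    ‖x - (t : ℂ) • g‖ ^ 2 = ‖x‖ ^ 2 - 2 * t * (inner ℂ g x : ℂ).re + t ^ 2 * ‖g‖ ^ 2 := by
  have h := norm_sub_sq (𝕜 := ℂ) x ((t : ℂ) • g)
  rw [h, inner_smul_right, norm_smul]
  have : (inner ℂ x g : ℂ).re = (inner ℂ g x : ℂ).re := inner_re_symm (𝕜 := ℂ) x g
  simp [mul_pow, this]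
  ring

/-- Averaged explicit Euler iterates are approximate solutions of the variational inequality of a
coercive monotone map that is bounded on a suitable ball. -/
lemma exists_approx_variational_inequality (G : H → H) (f C : ℝ)
    (hcoer : ∀ z, ‖z‖ ^ 2 - f * ‖z‖ ≤ (inner ℂ (G z) z : ℂ).re)
    (hbdd : ∀ z, ‖z‖ ^ 2 ≤ f ^ 2 + 1 → ‖G z‖ ≤ C)
    (hmono : ∀ z a, 0 ≤ (inner ℂ (G z - G a) (z - a) : ℂ).re) (η : ℝ) (hη : 0 < η) :
    ∃ w : H, ‖w‖ ≤ √(f ^ 2 + 1) ∧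
      ∀ a, (inner ℂ (G a) (w - a) : ℂ).re ≤ η * (‖a‖ ^ 2 + 1) := by
  have hC1 : 0 < C ^ 2 + 1 := by positivity
  obtain ⟨t, ht, ht1, htC, htη⟩ : ∃ t : ℝ, 0 < t ∧ t ≤ 1 ∧ t * C ^ 2 ≤ 1 ∧ t * C ^ 2 ≤ η := by
    have hm : 0 < min 1 η := lt_min one_pos hη
    have hle : min 1 η / (C ^ 2 + 1) * C ^ 2 ≤ min 1 η := by
      rw [div_mul_eq_mul_div, div_le_iff₀ hC1]
      nlinarith [sq_nonneg C]
    refine ⟨min 1 η / (C ^ 2 + 1), by positivity, ?_, hle.trans (min_le_left _ _),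
      hle.trans (min_le_right _ _)⟩
    rw [div_le_one hC1]
    nlinarith [sq_nonneg C, min_le_left 1 η]
  set z : ℕ → H := fun k => (fun x => x - (t : ℂ) • G x)^[k] 0
  have hz0 : z 0 = 0 := rfl
  have hzs : ∀ k, z (k + 1) = z k - (t : ℂ) • G (z k) := fun k =>
    Function.iterate_succ_apply' _ _ _
  have hGsq : ∀ x, ‖x‖ ^ 2 ≤ f ^ 2 + 1 → ‖G x‖ ^ 2 ≤ C ^ 2 := fun x hx =>
    pow_le_pow_left₀ (norm_nonneg _) (hbdd x hx) 2
  have hball : ∀ k, ‖z k‖ ^ 2 ≤ f ^ 2 + 1 := by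
    intro k
    induction k with
    | zero => rw [hz0]; simp; positivity
    | succ k ih =>
      rw [hzs, norm_sub_smul_sq_eq]
      have h1 := mul_le_mul_of_nonneg_left (hcoer (z k)) ht.le
      have h2 : t ^ 2 * ‖G (z k)‖ ^ 2 ≤ t := by
        calc t ^ 2 * ‖G (z k)‖ ^ 2 ≤ t ^ 2 * C ^ 2 :=
            mul_le_mul_of_nonneg_left (hGsq _ ih) (sq_nonneg t)
          _ = t * (t * C ^ 2) := by ring
          _ ≤ t * 1 := by gcongr
          _ = t := mul_one t
      have h3 := mul_nonneg ht.le (sq_nonneg (‖z k‖ - f))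
      have h4 := mul_le_mul_of_nonneg_left ih (sub_nonneg.2 ht1)
      nlinarith
  have hsum : ∀ a n, 2 * t * ∑ k ∈ Finset.range n, (inner ℂ (G a) (z k - a) : ℂ).re
      ≤ ‖a‖ ^ 2 - ‖z n - a‖ ^ 2 + n * (t ^ 2 * C ^ 2) := by
    intro a n
    induction n with
    | zero => simp [hz0]
    | succ n ih =>
      rw [Finset.sum_range_succ, hzs, sub_right_comm, norm_sub_smul_sq_eq]
      have h1 := hmono (z n) a
      rw [inner_sub_left, Complex.sub_re] at h1
      have h2 : t ^ 2 * ‖G (z n)‖ ^ 2 ≤ t ^ 2 * C ^ 2 :=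
        mul_le_mul_of_nonneg_left (hGsq _ (hball n)) (sq_nonneg t)
      have h3 := mul_nonneg ht.le h1
      push_cast
      nlinarith
  obtain ⟨n, hn⟩ := exists_nat_gt (1 / (t * η))
  have hn0 : (0 : ℝ) < n := lt_trans (by positivity) hn
  have hnη : 1 ≤ n * t * η := by
    rw [div_lt_iff₀ (by positivity)] at hn
    nlinarith
  refine ⟨((n : ℝ)⁻¹ : ℂ) • ∑ k ∈ Finset.range n, z k, ?_, fun a => ?_⟩
  · rw [norm_smul]
    have h1 : ‖∑ k ∈ Finset.range n, z k‖ ≤ n * √(f ^ 2 + 1) := by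
      refine (norm_sum_le _ _).trans ?_
      refine (Finset.sum_le_card_nsmul _ _ (√(f ^ 2 + 1)) fun k _ =>
        Real.le_sqrt_of_sq_le (hball k)).trans ?_
      simp
    simp only [Complex.ofReal_natCast, norm_inv, Complex.norm_natCast]
    rw [inv_mul_le_iff₀ hn0]
    exact h1
  · have hwa : ((n : ℝ)⁻¹ : ℂ) • ∑ k ∈ Finset.range n, z k - a
        = (((n : ℝ)⁻¹ : ℝ) : ℂ) • ∑ k ∈ Finset.range n, (z k - a) := by
      rw [Finset.sum_sub_distrib, smul_sub, Finset.sum_const, Finset.card_range,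
        ← Nat.cast_smul_eq_nsmul ℂ, smul_smul]
      have : (n : ℂ) ≠ 0 := by exact_mod_cast hn0.ne'
      simp [this]
    rw [hwa, inner_smul_right, Complex.re_ofReal_mul, inner_sum, Complex.re_sum,
      inv_mul_le_iff₀ hn0]
    have h1 := hsum a n
    have h2 : n * (t ^ 2 * C ^ 2) ≤ n * t * η := by
      have := mul_le_mul_of_nonneg_left htη (mul_nonneg hn0.le ht.le)
      nlinarith
    have h3 : ‖a‖ ^ 2 ≤ n * t * η * ‖a‖ ^ 2 := le_mul_of_one_le_left (sq_nonneg _) hnη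
    have h4 : 2 * t * ∑ k ∈ Finset.range n, (inner ℂ (G a) (z k - a) : ℂ).re
        ≤ 2 * t * (n * (η * (‖a‖ ^ 2 + 1))) := by
      have : 0 ≤ n * t * η := by positivity
      nlinarith [sq_nonneg ‖z n - a‖, mul_nonneg this (sq_nonneg ‖a‖)]
    exact le_of_mul_le_mul_left h4 (by positivity)

lemma re_inner_le_of_projection (P : H →L[ℂ] H) (hPP : ∀ x, P (P x) = P x)
    (hPs : ∀ x y, (inner ℂ (P x) y : ℂ) = inner ℂ x (P y)) (n d : H) :
    (inner ℂ n d : ℂ).re ≤ ‖P n‖ * ‖P d‖ + (inner ℂ n (d - P d) : ℂ).re := by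
  have h1 : (inner ℂ n (P d) : ℂ) = inner ℂ (P n) (P d) := by rw [hPs, hPP]
  have h2 := (Complex.re_le_norm _).trans (norm_inner_le_norm (𝕜 := ℂ) (P n) (P d))
  rw [inner_sub_right, Complex.sub_re, h1]
  linarith

variable [CompleteSpace H]

/-- **Browder–Minty**: a perturbation of the identity by a bounded, demicontinuous, monotone map
has a zero. -/
theorem exists_add_eq_zero_of_monotone (F : H → H)
    (hbdd : ∀ R : ℝ, ∃ C : ℝ, ∀ z, ‖z‖ ≤ R → ‖F z‖ ≤ C)
    (hdemi : ∀ (u : ℕ → H) (u₀ : H), Tendsto u atTop (𝓝 u₀) →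
      ∀ v : H, Tendsto (fun k => (inner ℂ v (F (u k)) : ℂ)) atTop (𝓝 (inner ℂ v (F u₀))))
    (hmono : ∀ z a, 0 ≤ (inner ℂ (F z - F a) (z - a) : ℂ).re) :
    ∃ z, z + F z = 0 := by
  set G : H → H := fun z => z + F z with hG
  have hGmono : ∀ z a, 0 ≤ (inner ℂ (G z - G a) (z - a) : ℂ).re := by
    intro z a
    have h1 : G z - G a = (z - a) + (F z - F a) := by simp only [hG]; abel
    rw [h1, inner_add_left, Complex.add_re]
    exact add_nonneg (inner_self_nonneg (𝕜 := ℂ)) (hmono z a)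
  have hcoer : ∀ z, ‖z‖ ^ 2 - ‖F 0‖ * ‖z‖ ≤ (inner ℂ (G z) z : ℂ).re := by
    intro z
    have h1 := hmono z 0
    rw [sub_zero, inner_sub_left, Complex.sub_re] at h1
    have h2 : (inner ℂ z z : ℂ).re = ‖z‖ ^ 2 := inner_self_eq_norm_sq (𝕜 := ℂ) z
    have h3 := (abs_le.1 ((Complex.abs_re_le_norm _).trans (norm_inner_le_norm (𝕜 := ℂ) (F 0) z))).1
    simp only [hG]
    rw [inner_add_left, Complex.add_re, h2]
    linarith
  obtain ⟨C, hC⟩ := hbdd √(‖F 0‖ ^ 2 + 1)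
  have happrox : ∀ m : ℕ, ∃ w : H, ‖w‖ ≤ √(‖F 0‖ ^ 2 + 1) ∧
      ∀ a, (inner ℂ (G a) (w - a) : ℂ).re ≤ 1 / ((m : ℝ) + 1) * (‖a‖ ^ 2 + 1) := fun m =>
    exists_approx_variational_inequality G ‖F 0‖ (√(‖F 0‖ ^ 2 + 1) + C) hcoer
      (fun z hz => (norm_add_le _ _).trans
        (add_le_add (Real.le_sqrt_of_sq_le hz) (hC z (Real.le_sqrt_of_sq_le hz)))) hGmono _
      (by positivity)
  choose w hwR hw using happrox
  let U : Ultrafilter ℕ := Filter.hyperfilter ℕ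
  have hU : (U : Filter ℕ) ≤ atTop := by
    rw [← Nat.cofinite_eq_atTop]; exact Filter.hyperfilter_le_cofinite
  let g : ℕ → WeakDual ℂ H := fun m => StrongDual.toWeakDual (InnerProductSpace.toDual ℂ H (w m))
  obtain ⟨φ, -, hφ⟩ := isCompact_iff_ultrafilter_le_nhds.1
    (WeakDual.isCompact_closedBall (𝕜 := ℂ) (E := H) 0 √(‖F 0‖ ^ 2 + 1)) (U.map g) (by
      rw [le_principal_iff]
      refine Filter.mem_map.2 (Filter.univ_mem' fun m => ?_)
      simpa [g] using hwR m)
  set z : H := (InnerProductSpace.toDual ℂ H).symm (WeakDual.toStrongDual φ)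
  have hlim : ∀ x : H, Tendsto (fun m => (inner ℂ (w m) x : ℂ)) U (𝓝 (inner ℂ z x)) := by
    intro x
    have h1 : Tendsto (fun m => (g m) x) U (𝓝 (φ x)) :=
      ((WeakDual.eval_continuous x).tendsto φ).comp hφ
    have h2 : (inner ℂ z x : ℂ) = φ x := InnerProductSpace.toDual_symm_apply
    rw [h2]
    exact h1
  have hvar : ∀ a, (inner ℂ (G a) (z - a) : ℂ).re ≤ 0 := by
    intro a
    have h1 : Tendsto (fun m => (inner ℂ (w m) (G a) : ℂ).re - (inner ℂ a (G a) : ℂ).re) U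
        (𝓝 ((inner ℂ z (G a) : ℂ).re - (inner ℂ a (G a) : ℂ).re)) :=
      ((Complex.continuous_re.tendsto _).comp (hlim (G a))).sub_const _
    have h2 : Tendsto (fun m : ℕ => 1 / ((m : ℝ) + 1) * (‖a‖ ^ 2 + 1)) U (𝓝 0) := by
      simpa using
        ((tendsto_one_div_add_atTop_nhds_zero_nat (𝕜 := ℝ)).mul_const (‖a‖ ^ 2 + 1)).mono_left hU
    have hre : ∀ x : H, (inner ℂ (G a) (x - a) : ℂ).re
        = (inner ℂ x (G a) : ℂ).re - (inner ℂ a (G a) : ℂ).re := by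
      intro x
      rw [← Complex.sub_re, ← inner_sub_left]
      exact inner_re_symm (𝕜 := ℂ) _ _
    rw [hre]
    refine le_of_tendsto_of_tendsto' h1 h2 fun m => ?_
    rw [← hre]
    exact hw m a
  refine ⟨z, ?_⟩
  change G z = 0
  set v := G z
  have hs : ∀ k : ℕ, (inner ℂ v (G (z - ((1 / ((k : ℝ) + 1) : ℝ) : ℂ) • v)) : ℂ).re ≤ 0 := by
    intro k
    have h1 := hvar (z - ((1 / ((k : ℝ) + 1) : ℝ) : ℂ) • v)
    rw [sub_sub_cancel, inner_smul_right, Complex.re_ofReal_mul] at h1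
    have h2 : (0 : ℝ) < 1 / ((k : ℝ) + 1) := by positivity
    have h3 := nonpos_of_mul_nonpos_right h1 h2
    exact (inner_re_symm (𝕜 := ℂ) _ _).trans_le h3
  have hu : Tendsto (fun k : ℕ => z - ((1 / ((k : ℝ) + 1) : ℝ) : ℂ) • v) atTop (𝓝 z) := by
    have h1 : Tendsto (fun k : ℕ => ((1 / ((k : ℝ) + 1) : ℝ) : ℂ)) atTop (𝓝 ((0 : ℝ) : ℂ)) :=
      (Complex.continuous_ofReal.tendsto 0).comp tendsto_one_div_add_atTop_nhds_zero_nat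
    simpa using (h1.smul_const v).const_sub z
  have hGlim := ((tendsto_const_nhds (x := v)).inner hu (𝕜 := ℂ)).add (hdemi _ _ hu v)
  have hle := le_of_tendsto' ((Complex.continuous_re.tendsto _).comp hGlim) fun k => by
    have := hs k
    simp only [hG, inner_add_right] at this
    exact this
  rw [← inner_add_right] at hle
  have hvv : (inner ℂ v v : ℂ).re ≤ 0 := hle
  have h2 : (inner ℂ v v : ℂ).re = ‖v‖ ^ 2 := inner_self_eq_norm_sq (𝕜 := ℂ) v
  rw [h2] at hvv
  exact norm_eq_zero.1 (pow_eq_zero_iff two_ne_zero |>.1 (le_antisymm hvv (sq_nonneg _)))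

/-- A coercive self-adjoint operator with domain `dom` has a bounded everywhere defined inverse. -/
theorem exists_inverse_of_selfAdjoint_of_coercive (dom : Submodule ℂ H) (T : dom →ₗ[ℂ] H) (c : ℝ)
    (hc : 0 < c)
    (hsymm : ∀ u v : dom, (inner ℂ (T u) (v : H) : ℂ) = inner ℂ (u : H) (T v))
    (hself : ∀ v w : H, (∀ u : dom, (inner ℂ v (T u) : ℂ) = inner ℂ w (u : H)) →
      ∃ hv : v ∈ dom, T ⟨v, hv⟩ = w)
    (hcoer : ∀ u : dom, c * ‖(u : H)‖ ^ 2 ≤ (inner ℂ (T u) (u : H) : ℂ).re) :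
    ∃ K : H →L[ℂ] H, (∀ y, ∃ hy : K y ∈ dom, T ⟨K y, hy⟩ = y) ∧ ∀ u : dom, K (T u) = u := by
  have hlow : ∀ u : dom, c * ‖(u : H)‖ ≤ ‖T u‖ := by
    intro u
    rcases (norm_nonneg (u : H)).eq_or_lt with h0 | h0
    · rw [← h0, mul_zero]; exact norm_nonneg _
    · have h1 := (hcoer u).trans
        ((Complex.re_le_norm _).trans (norm_inner_le_norm (𝕜 := ℂ) (T u) (u : H)))
      refine le_of_mul_le_mul_right ?_ h0
      nlinarith
  have hinj : Function.Injective T := by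
    rw [injective_iff_map_eq_zero]
    intro u hu
    have := hlow u
    rw [hu, norm_zero] at this
    have h0 : ‖(u : H)‖ ≤ 0 := nonpos_of_mul_nonpos_right this hc
    exact Subtype.ext (norm_le_zero_iff.1 h0)
  have hclosed : IsClosed ((LinearMap.range T : Submodule ℂ H) : Set H) := by
    refine isClosed_of_closure_subset fun w hw => ?_
    obtain ⟨y, hy, hyw⟩ := mem_closure_iff_seq_limit.1 hw
    choose u hu using hy
    have hcau : CauchySeq fun k => (u k : H) := by
      rw [Metric.cauchySeq_iff']
      intro e he
      obtain ⟨M, hM⟩ := Metric.cauchySeq_iff'.1 hyw.cauchySeq (c * e) (by positivity)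
      refine ⟨M, fun n hn => ?_⟩
      have h1 := hM n hn
      have h2 := hlow (u n - u M)
      rw [map_sub, hu, hu] at h2
      rw [dist_eq_norm] at h1 ⊢
      exact lt_of_mul_lt_mul_left (lt_of_le_of_lt h2 h1) hc.le
    obtain ⟨x, hx⟩ := cauchySeq_tendsto_of_complete hcau
    obtain ⟨hxd, hTx⟩ := hself x w fun v =>
      tendsto_nhds_unique (hx.inner tendsto_const_nhds)
        ((hyw.inner (tendsto_const_nhds (x := (v : H)))).congr fun k => by rw [← hu, hsymm])
    exact ⟨_, hTx⟩
  have hsurj : Function.Surjective T := by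
    have hcomplete : CompleteSpace (LinearMap.range T : Submodule ℂ H) :=
      hclosed.completeSpace_coe
    rw [← LinearMap.range_eq_top, ← Submodule.orthogonal_eq_bot_iff, Submodule.eq_bot_iff]
    intro v hv
    obtain ⟨hvd, hTv⟩ := hself v 0 fun u => by
      rw [inner_zero_left]
      exact (Submodule.mem_orthogonal' _ _).1 hv _ ⟨u, rfl⟩
    have := hinj (hTv.trans (map_zero T).symm)
    simpa using congrArg Subtype.val this
  let e := LinearEquiv.ofBijective T ⟨hinj, hsurj⟩
  have he : ∀ y, T (e.symm y) = y := fun y => e.apply_symm_apply y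
  let K : H →L[ℂ] H := (dom.subtype ∘ₗ e.symm.toLinearMap).mkContinuous c⁻¹ fun y => by
    rw [← div_eq_inv_mul, le_div_iff₀' hc]
    simpa [he] using hlow (e.symm y)
  refine ⟨K, fun y => ⟨(e.symm y).2, he y⟩, fun u => ?_⟩
  exact congrArg Subtype.val (e.symm_apply_apply u)

/-- Solvability, with a bounded and continuous solution map, of the component of a Hammerstein
equation on the range of the projection `P` when the nonlinearity is cocoercive along `P`. -/
lemma exists_solution_map (P J : H →L[ℂ] H) (hPP : ∀ x, P (P x) = P x)
    (hPs : ∀ x y, (inner ℂ (P x) y : ℂ) = inner ℂ x (P y)) (hPn : ∀ x, ‖P x‖ ≤ ‖x‖)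
    (κ α : ℝ) (hκ : 0 < κ) (hκα : κ * α⁻¹ < 1) (hα : 0 < α)
    (hJP : ∀ y, P (J y) = J y) (hJ : ∀ y, ‖J y‖ ≤ κ * ‖P y‖)
    (N : H → H) (hNbdd : ∀ R : ℝ, ∃ C : ℝ, ∀ z, ‖z‖ ≤ R → ‖N z‖ ≤ C)
    (hNmono : ∀ u u' : H,
      α * ‖P (N u - N u')‖ ^ 2 ≤ (inner ℂ (N u - N u') (u - u') : ℂ).re) (h : H) :
    ∃ U : H → H, (∀ v, P (U v) = J (N (U v) - h)) ∧ (∀ v, U v - P (U v) = v - P v) ∧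
      (∀ R : ℝ, ∃ C : ℝ, ∀ v, ‖v‖ ≤ R → ‖U v‖ ≤ C) ∧ Continuous U := by
  have hlip : ∀ u u', u - P u = u' - P u' → ‖P (N u - N u')‖ ≤ α⁻¹ * ‖P u - P u'‖ := by
    intro u u' huu
    have h0 : u - u' - P (u - u') = 0 := by
      rw [map_sub, sub_sub_sub_comm, huu, sub_self]
    have h1 := (hNmono u u').trans (re_inner_le_of_projection P hPP hPs _ _)
    rw [h0, inner_zero_right, Complex.zero_re, add_zero, map_sub P u] at h1
    rw [← div_eq_inv_mul, le_div_iff₀' hα]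
    rcases (norm_nonneg (P (N u - N u'))).eq_or_lt with h2 | h2
    · rw [← h2, mul_zero]; exact norm_nonneg _
    · refine le_of_mul_le_mul_left ?_ h2
      nlinarith
  have hfix : ∀ v, ∃ x, J (N (P x + (v - P v)) - h) = x := by
    intro v
    have hcon : ContractingWith (κ * α⁻¹).toNNReal fun x => J (N (P x + (v - P v)) - h) := by
      refine ⟨by rw [Real.toNNReal_lt_one]; exact hκα, LipschitzWith.of_dist_le_mul fun x y => ?_⟩
      rw [dist_eq_norm, dist_eq_norm, Real.coe_toNNReal _ (by positivity), ← map_sub,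
        sub_sub_sub_cancel_right]
      refine (hJ _).trans ?_
      rw [mul_assoc]
      refine mul_le_mul_of_nonneg_left ?_ hκ.le
      refine (hlip _ _ (by simp [hPP])).trans ?_
      refine mul_le_mul_of_nonneg_left ?_ (inv_nonneg.2 hα.le)
      simpa [hPP] using hPn (x - y)
    exact ⟨_, hcon.fixedPoint_isFixedPt⟩
  choose X hX using hfix
  have hPX : ∀ v, P (X v) = X v := fun v => by rw [← hX v, hJP]
  set U : H → H := fun v => X v + (v - P v) with hU
  have hPU : ∀ v, P (U v) = X v := fun v => by simp [hU, hPX, hPP]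
  have hUJ : ∀ v, P (U v) = J (N (U v) - h) := fun v => by
    rw [hPU]
    conv_lhs => rw [← hX v, hPX]
  have hUQ : ∀ v, U v - P (U v) = v - P v := fun v => by rw [hPU]; simp [hU]
  have hq : ∀ v : H, ‖v - P v‖ ≤ 2 * ‖v‖ := fun v => by
    have := norm_sub_le v (P v)
    linarith [hPn v]
  have hUbdd : ∀ R : ℝ, ∃ C : ℝ, ∀ v, ‖v‖ ≤ R → ‖U v‖ ≤ C := by
    intro R
    obtain ⟨C, hC⟩ := hNbdd (2 * R)
    refine ⟨κ * (C + ‖h‖) / (1 - κ * α⁻¹) + 2 * R, fun v hv => ?_⟩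
    have h1 : ‖X v‖ ≤ κ * (C + ‖h‖) / (1 - κ * α⁻¹) := by
      rw [le_div_iff₀ (by linarith)]
      have h2 := hlip (U v) (v - P v) (by rw [hUQ]; simp [hPP])
      rw [hPU] at h2
      simp only [map_sub, hPP, sub_self, sub_zero] at h2
      have h3 : P (N (U v) - h) = (P (N (U v)) - P (N (v - P v))) + P (N (v - P v) - h) := by
        rw [map_sub, map_sub]; abel
      have h4 : ‖P (N (v - P v) - h)‖ ≤ C + ‖h‖ :=
        (hPn _).trans ((norm_sub_le _ _).trans
          (add_le_add_left (hC _ ((hq v).trans (by linarith))) _))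
      have h5 := hJ (N (U v) - h)
      rw [← hUJ, hPU, h3] at h5
      have h6 := h5.trans (mul_le_mul_of_nonneg_left ((norm_add_le _ _).trans
        (add_le_add h2 h4)) hκ.le)
      linarith
    exact (norm_add_le _ _).trans (add_le_add h1 ((hq v).trans (by linarith)))
  refine ⟨U, hUJ, hUQ, hUbdd, continuous_iff_seqContinuous.2 fun v v₀ hv => ?_⟩
  have hκα' : κ < α := by
    rw [mul_inv_lt_iff₀ hα, one_mul] at hκα; exact hκα
  obtain ⟨R, hR⟩ := hv.norm.bddAbove_range
  obtain ⟨C₁, hC₁⟩ := hUbdd R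
  obtain ⟨C₂, hC₂⟩ := hNbdd C₁
  have hNb : ∀ k, ‖N (U (v k)) - N (U v₀)‖ ≤ C₂ + ‖N (U v₀)‖ := fun k =>
    (norm_sub_le _ _).trans (add_le_add_left (hC₂ _ (hC₁ _ (hR ⟨k, rfl⟩))) _)
  have hQ : Tendsto (fun k => ‖(v k - v₀) - P (v k - v₀)‖) atTop (𝓝 0) := by
    have h1 : Tendsto (fun k => v k - v₀) atTop (𝓝 0) := by simpa using hv.sub_const v₀
    simpa using (h1.sub ((P.continuous.tendsto 0).comp h1)).norm
  have hPd : ∀ k, P (U (v k) - U v₀) = J (N (U (v k)) - N (U v₀)) := fun k => by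
    rw [map_sub, hUJ, hUJ, ← map_sub, sub_sub_sub_cancel_right]
  have hQd : ∀ k, U (v k) - U v₀ - P (U (v k) - U v₀) = v k - v₀ - P (v k - v₀) := fun k => by
    rw [map_sub, map_sub, sub_sub_sub_comm, hUQ, hUQ, sub_sub_sub_comm]
  have hest : ∀ k, ‖P (N (U (v k)) - N (U v₀))‖ ^ 2
      ≤ (C₂ + ‖N (U v₀)‖) / (α - κ) * ‖(v k - v₀) - P (v k - v₀)‖ := by
    intro k
    rw [div_mul_eq_mul_div, le_div_iff₀ (by linarith)]
    have h1 := (hNmono (U (v k)) (U v₀)).trans (re_inner_le_of_projection P hPP hPs _ _)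
    rw [hQd, hPd] at h1
    have h2 := (Complex.re_le_norm _).trans (norm_inner_le_norm (𝕜 := ℂ)
      (N (U (v k)) - N (U v₀)) (v k - v₀ - P (v k - v₀)))
    have h3 := mul_le_mul_of_nonneg_right (hNb k) (norm_nonneg (v k - v₀ - P (v k - v₀)))
    have h4 := mul_le_mul_of_nonneg_left (hJ (N (U (v k)) - N (U v₀)))
      (norm_nonneg (P (N (U (v k)) - N (U v₀))))
    nlinarith
  have hPN : Tendsto (fun k => ‖P (N (U (v k)) - N (U v₀))‖) atTop (𝓝 0) := by
    have h1 : Tendsto (fun k => ‖P (N (U (v k)) - N (U v₀))‖ ^ 2) atTop (𝓝 0) :=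
      squeeze_zero (fun k => sq_nonneg _) hest (by simpa using hQ.const_mul _)
    simpa using h1.sqrt
  rw [tendsto_iff_norm_sub_tendsto_zero]
  have hlim := (hPN.const_mul κ).add hQ
  rw [mul_zero, add_zero] at hlim
  refine squeeze_zero (fun k => norm_nonneg _) (fun k => ?_) hlim
  calc ‖U (v k) - U v₀‖
      = ‖P (U (v k) - U v₀) + (U (v k) - U v₀ - P (U (v k) - U v₀))‖ := by
        rw [add_sub_cancel]
    _ ≤ _ := (norm_add_le _ _).trans (by
        rw [hQd, hPd]; exact add_le_add_left (hJ _) _)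

/-- Solvability of a Hammerstein equation whose kernel is nonnegative on the kernel of `P` and
dominated by the cocoercivity of the nonlinearity on the range of `P`. -/
theorem exists_hammerstein_solution (P J B : H →L[ℂ] H) (hPP : ∀ x, P (P x) = P x)
    (hPs : ∀ x y, (inner ℂ (P x) y : ℂ) = inner ℂ x (P y)) (hPn : ∀ x, ‖P x‖ ≤ ‖x‖)
    (κ α : ℝ) (hκ : 0 < κ) (hκα : κ * α⁻¹ < 1) (hα : 0 < α)
    (hJP : ∀ y, P (J y) = J y) (hJ : ∀ y, ‖J y‖ ≤ κ * ‖P y‖) (hB : 0 ≤ B)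
    (N : H → H) (hNbdd : ∀ R : ℝ, ∃ C : ℝ, ∀ z, ‖z‖ ≤ R → ‖N z‖ ≤ C)
    (hNdemi : ∀ (u : ℕ → H) (u₀ : H), Tendsto u atTop (𝓝 u₀) →
      ∀ v : H, Tendsto (fun k => (inner ℂ v (N (u k)) : ℂ)) atTop (𝓝 (inner ℂ v (N u₀))))
    (hNmono : ∀ u u' : H,
      α * ‖P (N u - N u')‖ ^ 2 ≤ (inner ℂ (N u - N u') (u - u') : ℂ).re) (h : H) :
    ∃ u : H, P u = J (N u - h) ∧
      u - P u = B (h - N u - P (h - N u)) - P (B (h - N u - P (h - N u))) := by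
  obtain ⟨U, hUJ, hUQ, hUbdd, hUc⟩ :=
    exists_solution_map P J hPP hPs hPn κ α hκ hκα hα hJP hJ N hNbdd hNmono h
  set S : H →L[ℂ] H := CFC.sqrt B
  have hSS : ∀ x, S (S x) = B x := fun x => by
    rw [← CFC.sqrt_mul_sqrt_self B hB]; rfl
  have hSs : ∀ x y, (inner ℂ (S x) y : ℂ) = inner ℂ x (S y) := fun x y =>
    ((ContinuousLinearMap.nonneg_iff_isPositive S).1 (CFC.sqrt_nonneg B)).isSelfAdjoint.isSymmetric
      x y
  have hQs : ∀ x y : H, (inner ℂ (x - P x) y : ℂ) = inner ℂ x (y - P y) := fun x y => by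
    rw [inner_sub_left, inner_sub_right, hPs]
  set F : H → H := fun z => S (N (U (S z)) - h - P (N (U (S z)) - h)) with hF
  obtain ⟨z, hz⟩ := exists_add_eq_zero_of_monotone F (by
    intro R
    obtain ⟨C₁, hC₁⟩ := hUbdd (‖S‖ * R)
    obtain ⟨C₂, hC₂⟩ := hNbdd C₁
    refine ⟨‖S‖ * (2 * (C₂ + ‖h‖)), fun z hz => (S.le_opNorm _).trans ?_⟩
    refine mul_le_mul_of_nonneg_left ?_ (norm_nonneg _)
    have h1 := hC₂ _ (hC₁ (S z) ((S.le_opNorm z).trans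
      (mul_le_mul_of_nonneg_left hz (norm_nonneg _))))
    have h2 := norm_sub_le (N (U (S z))) h
    have h3 := norm_sub_le (N (U (S z)) - h) (P (N (U (S z)) - h))
    linarith [hPn (N (U (S z)) - h)]) (by
    intro u u₀ hu v
    have h1 := hNdemi _ _ (((hUc.comp S.continuous).tendsto u₀).comp hu) (S v - P (S v))
    have h2 : ∀ z, (inner ℂ v (F z) : ℂ)
        = inner ℂ (S v - P (S v)) (N (U (S z))) - inner ℂ (S v - P (S v)) h := fun z => by
      rw [← inner_sub_right, hQs, hSs]
    simp only [h2]
    exact h1.sub_const _) (by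
    intro z a
    set n := N (U (S z)) - N (U (S a)) with hn
    have h1 : F z - F a = S (n - P n) := by
      simp only [hF, hn]
      rw [← map_sub, ← sub_sub_sub_cancel_right (N (U (S z))) (N (U (S a))) h, map_sub P (_ - h)]
      congr 1; abel
    have h2 : S (z - a) - P (S (z - a)) = U (S z) - U (S a) - P (U (S z) - U (S a)) := by
      rw [map_sub S, map_sub P, map_sub P, sub_sub_sub_comm, ← hUQ (S z), ← hUQ (S a),
        sub_sub_sub_comm]
    have h3 : P (U (S z) - U (S a)) = J n := by
      rw [map_sub, hUJ, hUJ, ← map_sub, sub_sub_sub_cancel_right]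
    rw [h1, hSs, hQs, h2]
    have h4 := (hNmono (U (S z)) (U (S a))).trans (re_inner_le_of_projection P hPP hPs _ _)
    rw [← hn] at h4
    have h5 : κ < α := by
      rw [mul_inv_lt_iff₀ hα, one_mul] at hκα; exact hκα
    have h6 := mul_le_mul_of_nonneg_left (hJ n) (norm_nonneg (P n))
    rw [← h3] at h6
    nlinarith [mul_nonneg (sub_nonneg.2 h5.le) (sq_nonneg ‖P n‖)])
  refine ⟨U (S z), hUJ _, ?_⟩
  rw [hUQ]
  have h1 : S z = B (h - N (U (S z)) - P (h - N (U (S z)))) := by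
    conv_lhs => rw [eq_neg_of_add_eq_zero_left hz]
    simp only [hF]
    rw [map_neg, hSS, ← map_neg, ← neg_sub (N (U (S z))) h, map_neg P]
    congr 1; abel
  exact congrArg (fun x => x - P x) h1

end MonotoneOperators


/-- (General spectral-gap setting.) `H` is a complex separable Hilbert space,
`H = H₁ ⊕ H₁ᗮ` with `H₁` closed and `P₁` the orthogonal projection onto `H₁`; `L` is a densely
defined self-adjoint operator with `H₁ ⊆ dom L`, leaving `H₁` and `H₁ᗮ` invariant, with
`−γ‖u₁‖² ≤ Re⟪Lu₁, u₁⟫ ≤ −δ‖u₁‖²` on `H₁` (`γ ≥ δ > 0`) and `Re⟪Lu₂, u₂⟫ ≥ 0` on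
`dom L ∩ H₁ᗮ`. If `N` is bounded, demicontinuous, `N(0) = 0`, and there is `α > γ/δ²` with
`Re⟪N(u) − N(u'), u − u'⟫ ≥ α‖P₁(N(u) − N(u'))‖²`, then for every `ε > 0` and `h ∈ H` the
perturbed equation `ε P₂u + Lu + N(u) = h` has exactly one solution in `dom L`. -/
theorem stmt_14 {H : Type*} [NormedAddCommGroup H] [InnerProductSpace ℂ H] [CompleteSpace H]
    [TopologicalSpace.SeparableSpace H]
    (H₁ dom : Submodule ℂ H) (hcl : IsClosed (H₁ : Set H))
    (hdense : Dense (dom : Set H)) (hH₁dom : H₁ ≤ dom)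
    (P₁ : H → H) (hP₁mem : ∀ u : H, P₁ u ∈ H₁) (hP₁orth : ∀ u : H, u - P₁ u ∈ H₁ᗮ)
    (L : H → H)
    (hlin : ∀ u ∈ dom, ∀ v ∈ dom, ∀ a b : ℂ, L (a • u + b • v) = a • L u + b • L v)
    (hsymm : ∀ u ∈ dom, ∀ v ∈ dom, (inner ℂ (L u) v : ℂ) = inner ℂ u (L v))
    (hselfadj : ∀ v w : H, (∀ u ∈ dom, (inner ℂ v (L u) : ℂ) = inner ℂ w u) → v ∈ dom ∧ L v = w)
    (hinv₁ : ∀ u ∈ H₁, L u ∈ H₁)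
    (hinv₂ : ∀ u ∈ dom, u ∈ H₁ᗮ → L u ∈ H₁ᗮ)
    (γ δ : ℝ) (hδ : 0 < δ) (hγδ : δ ≤ γ)
    (hcoer₁ : ∀ u ∈ H₁,
      -γ * ‖u‖ ^ 2 ≤ (inner ℂ (L u) u : ℂ).re ∧ (inner ℂ (L u) u : ℂ).re ≤ -δ * ‖u‖ ^ 2)
    (hnn₂ : ∀ u ∈ dom, u ∈ H₁ᗮ → 0 ≤ (inner ℂ (L u) u : ℂ).re)
    (N : H → H)
    (hNbdd : ∀ s : Set H, Bornology.IsBounded s → Bornology.IsBounded (N '' s))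
    (hNdemi : ∀ (u : ℕ → H) (u₀ : H), Tendsto u atTop (𝓝 u₀) →
      ∀ v : H, Tendsto (fun k => (inner ℂ v (N (u k)) : ℂ)) atTop (𝓝 (inner ℂ v (N u₀))))
    (hN0 : N 0 = 0)
    (hNmono : ∃ α : ℝ, γ / δ ^ 2 < α ∧ ∀ u u' : H,
      α * ‖P₁ (N u - N u')‖ ^ 2 ≤ (inner ℂ (N u - N u') (u - u') : ℂ).re)
    (ε : ℝ) (hε : 0 < ε) (h : H) :
    ∃! u : H, u ∈ dom ∧ (ε : ℂ) • (u - P₁ u) + L u + N u = h := by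
  obtain ⟨α, hα, hNmono⟩ := hNmono
  have hcomplete : CompleteSpace H₁ := hcl.completeSpace_coe
  obtain rfl : P₁ = H₁.starProjection := funext fun u =>
    (Submodule.eq_starProjection_of_mem_orthogonal (hP₁mem u) (hP₁orth u)).symm
  set P := H₁.starProjection
  have hPid : ∀ x ∈ H₁, P x = x := fun x hx => Submodule.starProjection_eq_self_iff.2 hx
  have hP0 : ∀ x ∈ H₁ᗮ, P x = 0 := fun x hx =>
    (Submodule.starProjection_apply_eq_zero_iff H₁).2 hx
  have hPP : ∀ x, P (P x) = P x := fun x => hPid _ (hP₁mem x)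
  have hPs : ∀ x y, (inner ℂ (P x) y : ℂ) = inner ℂ x (P y) :=
    Submodule.inner_starProjection_left_eq_right H₁
  have hPn : ∀ x, ‖P x‖ ≤ ‖x‖ := H₁.norm_starProjection_apply_le
  have hQs : ∀ x y : H, (inner ℂ (x - P x) y : ℂ) = inner ℂ x (y - P y) := fun x y => by
    rw [inner_sub_left, inner_sub_right, hPs]
  have hPdom : ∀ x, P x ∈ dom := fun x => hH₁dom (hP₁mem x)
  have hLadd : ∀ u ∈ dom, ∀ v ∈ dom, L (u + v) = L u + L v := fun u hu v hv => by
    simpa using hlin u hu v hv 1 1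
  have hLsub : ∀ u ∈ dom, ∀ v ∈ dom, L (u - v) = L u - L v := fun u hu v hv => by
    simpa [← sub_eq_add_neg] using hlin u hu v hv 1 (-1)
  have hLsmul : ∀ u ∈ dom, ∀ a : ℂ, L (a • u) = a • L u := fun u hu a => by
    simpa using hlin u hu u hu a 0
  have hLP : ∀ u ∈ dom, P (L u) = L (P u) := fun u hu => by
    have h1 := hLsub u hu (P u) (hPdom u)
    have h2 := hinv₂ _ (dom.sub_mem hu (hPdom u)) (hP₁orth u)
    have h3 := hP0 _ h2
    rw [h1, map_sub, hPid _ (hinv₁ _ (hP₁mem u))] at h3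
    exact sub_eq_zero.1 h3
  have hLPs : ∀ v, ∀ u ∈ dom, (inner ℂ v (L (P u)) : ℂ) = inner ℂ (L (P v)) u := fun v u hu => by
    rw [← hLP u hu, ← hPs, hsymm _ (hPdom v) _ hu]
  let Llin : dom →ₗ[ℂ] H :=
    { toFun := fun u => L u
      map_add' := fun u v => hLadd u u.2 v v.2
      map_smul' := fun a u => hLsmul u u.2 a }
  let LPlin : dom →ₗ[ℂ] H :=
    { toFun := fun u => L (P u)
      map_add' := fun u v => by
        rw [Submodule.coe_add, map_add]; exact hLadd _ (hPdom _) _ (hPdom _)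
      map_smul' := fun a u => by
        rw [Submodule.coe_smul, map_smul]; exact hLsmul _ (hPdom _) a }
  let T : dom →ₗ[ℂ] H :=
    (ε : ℂ) • (dom.subtype - P.toLinearMap ∘ₗ dom.subtype) + Llin - (2 : ℂ) • LPlin
  have hT : ∀ u : dom, T u = (ε : ℂ) • ((u : H) - P u) + L u - (2 : ℂ) • L (P u) := fun u => rfl
  have hTsymm : ∀ u v : dom, (inner ℂ (T u) (v : H) : ℂ) = inner ℂ (u : H) (T v) := fun u v => by
    rw [hT, hT]
    simp only [inner_sub_left, inner_sub_right, inner_add_left, inner_add_right, inner_smul_left,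
      inner_smul_right, hsymm _ u.2 _ v.2, hPs, hLPs _ _ v.2, Complex.conj_ofReal, map_ofNat]
  have hTself : ∀ v w : H, (∀ u : dom, (inner ℂ v (T u) : ℂ) = inner ℂ w (u : H)) →
      ∃ hv : v ∈ dom, T ⟨v, hv⟩ = w := by
    intro v w hvw
    obtain ⟨hv, hLv⟩ := hselfadj v (w - (ε : ℂ) • (v - P v) + (2 : ℂ) • L (P v)) fun u hu => by
      have h1 := hvw ⟨u, hu⟩
      rw [hT] at h1
      simp only [inner_sub_right, inner_add_right, inner_smul_right, hLPs _ _ hu] at h1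
      simp only [inner_sub_left, inner_add_left, inner_smul_left, hPs, Complex.conj_ofReal,
        map_ofNat]
      linear_combination h1
    refine ⟨hv, ?_⟩
    rw [hT, hLv]
    abel
  have hnsq : ∀ x : H, ‖x‖ ^ 2 = ‖P x‖ ^ 2 + ‖x - P x‖ ^ 2 := fun x => by
    have h1 := norm_add_sq_eq_norm_sq_add_norm_sq_of_inner_eq_zero (𝕜 := ℂ) (P x) (x - P x)
      ((Submodule.mem_orthogonal _ _).1 (hP₁orth x) _ (hP₁mem x))
    rw [add_sub_cancel] at h1
    simpa [sq] using h1
  have hQL : ∀ u ∈ dom, L u - L (P u) = L (u - P u) := fun u hu => (hLsub _ hu _ (hPdom u)).symm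
  have hTcoer : ∀ u : dom, min ε δ * ‖(u : H)‖ ^ 2 ≤ (inner ℂ (T u) (u : H) : ℂ).re := by
    intro u
    have h1 : T u = ((ε : ℂ) • ((u : H) - P u) + L (u - P u)) - L (P u) := by
      rw [hT, ← hQL _ u.2, two_smul]; abel
    have h2 : (inner ℂ ((u : H) - P u) (u : H) : ℂ) = inner ℂ ((u : H) - P u) ((u : H) - P u) := by
      rw [hQs, hQs]; simp [hPP]
    have h3 : (inner ℂ (L (u - P u)) (u : H) : ℂ) = inner ℂ (L (u - P u)) ((u : H) - P u) := by
      rw [← hQL _ u.2, ← hLP _ u.2, hQs, hQs]; simp [hPP]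
    have h4 : (inner ℂ (L (P u)) (u : H) : ℂ) = inner ℂ (L (P u)) (P u) := by
      rw [← hLP _ u.2, hPs, hPs, hPP]
    have h5 := hnn₂ _ (dom.sub_mem u.2 (hPdom u)) (hP₁orth u)
    have h6 := (hcoer₁ _ (hP₁mem u)).2
    have h7 : (inner ℂ ((u : H) - P u) ((u : H) - P u) : ℂ).re = ‖(u : H) - P u‖ ^ 2 :=
      inner_self_eq_norm_sq (𝕜 := ℂ) _
    rw [h1, inner_sub_left, inner_add_left, inner_smul_left, h2, h3, h4, Complex.conj_ofReal,
      Complex.sub_re, Complex.add_re, Complex.re_ofReal_mul, h7, hnsq]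
    nlinarith [mul_le_mul_of_nonneg_right (min_le_left ε δ) (sq_nonneg ‖(u : H) - P u‖),
      mul_le_mul_of_nonneg_right (min_le_right ε δ) (sq_nonneg ‖P (u : H)‖)]
  obtain ⟨K, hTK, hKT⟩ := exists_inverse_of_selfAdjoint_of_coercive dom T (min ε δ)
    (lt_min hε hδ) hTsymm hTself hTcoer
  have hKdom : ∀ y, K y ∈ dom := fun y => (hTK y).1
  have hKeq : ∀ y, (ε : ℂ) • (K y - P (K y)) + L (K y) - (2 : ℂ) • L (P (K y)) = y := fun y =>
    (hTK y).2
  have hKL : ∀ x ∈ H₁, K (L x) = -x := fun x hx => by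
    have h1 := hKT ⟨x, hH₁dom hx⟩
    rw [hT] at h1
    simp only [hPid x hx, sub_self, smul_zero, zero_add, two_smul, sub_add_cancel_left,
      map_neg] at h1
    exact neg_eq_iff_eq_neg.1 h1
  have hLPK : ∀ y, L (P (K y)) = -P y := fun y => by
    conv_rhs => rw [← hKeq y]
    simp only [map_sub, map_add, map_smul, hPP, hLP _ (hKdom y), hLP _ (hPdom _), sub_self,
      smul_zero, zero_add, two_smul]
    abel
  have hPK : ∀ y, P (K y) = K (P y) := fun y => by
    have h1 := hKL _ (hP₁mem (K y))
    rw [hLPK, map_neg] at h1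
    exact (neg_injective h1).symm
  have hlow : ∀ x ∈ H₁, δ * ‖x‖ ≤ ‖L x‖ := fun x hx => by
    rcases (norm_nonneg x).eq_or_lt with h0 | h0
    · rw [← h0, mul_zero]; exact norm_nonneg _
    · have h1 := (hcoer₁ x hx).2
      have h2 := (abs_le.1 ((Complex.abs_re_le_norm _).trans
        (norm_inner_le_norm (𝕜 := ℂ) (L x) x))).1
      refine le_of_mul_le_mul_right ?_ h0
      nlinarith
  have hKpos : 0 ≤ K := by
    rw [ContinuousLinearMap.nonneg_iff_isPositive, ContinuousLinearMap.isPositive_def]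
    refine ⟨fun x y => ?_, fun x => ?_⟩
    · obtain ⟨hx, hTx⟩ := hTK x
      obtain ⟨hy, hTy⟩ := hTK y
      have h1 := hTsymm ⟨_, hx⟩ ⟨_, hy⟩
      rw [hTx, hTy] at h1
      exact h1.symm
    · obtain ⟨hx, hTx⟩ := hTK x
      have h1 := hTcoer ⟨_, hx⟩
      rw [hTx] at h1
      refine le_trans ?_ (h1.trans_eq (inner_re_symm (𝕜 := ℂ) _ _))
      have := lt_min hε hδ
      positivity
  have hα₀ : δ⁻¹ < α := by
    refine lt_of_le_of_lt ?_ hα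
    rw [le_div_iff₀ (by positivity), sq, inv_mul_cancel_left₀ hδ.ne']
    exact hγδ
  have hαpos : 0 < α := (inv_pos.2 hδ).trans hα₀
  have hJ : ∀ y, ‖(K ∘L P) y‖ ≤ δ⁻¹ * ‖P y‖ := fun y => by
    have h1 := hlow _ (hP₁mem (K y))
    rw [hLPK, norm_neg, hPK] at h1
    rw [← div_eq_inv_mul, le_div_iff₀' hδ]
    exact h1
  refine existsUnique_of_exists_of_unique ?_ ?_
  · obtain ⟨u, hu₁, hu₂⟩ := exists_hammerstein_solution P (K ∘L P) K hPP hPs hPn δ⁻¹ α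
      (inv_pos.2 hδ) (by rw [mul_inv_lt_iff₀ hαpos, one_mul]; exact hα₀) hαpos
      (fun y => by simp [hPK, hPP]) hJ hKpos N
      (fun R => by
        obtain ⟨C, hC⟩ := (hNbdd _
          (Metric.isBounded_closedBall (x := (0 : H)) (r := R))).exists_norm_le
        exact ⟨C, fun z hz => hC _ ⟨z, by simpa using hz, rfl⟩⟩) hNdemi hNmono h
    set y := h - N u with hy
    have hu₂' : u - P u = K (y - P y) := by rw [hu₂, hPK]; simp [hPP]
    have hu₁' : P u = K (-P y) := by
      rw [hu₁, ← neg_sub h, ← hy]; simp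
    have hud : u ∈ dom := by
      rw [← add_sub_cancel (P u) u, hu₂']
      exact dom.add_mem (hPdom u) (hKdom _)
    refine ⟨u, hud, ?_⟩
    have h1 := hKeq (y - P y)
    rw [← hu₂'] at h1
    have h2 : L (P u) = P y := by
      have h3 := hLPK (-P y)
      rw [← hu₁', hPP, map_neg, neg_neg, hPP] at h3
      exact h3
    have h3 : P (u - P u) = 0 := by simp [hPP]
    have h4 : L 0 = 0 := by simpa using hLsmul 0 dom.zero_mem 0
    rw [h3, h4, smul_zero, sub_zero, sub_zero, ← hQL u hud, h2] at h1
    have h5 : (ε : ℂ) • (u - P u) + L u = y := by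
      rw [← sub_left_inj (a := P y), add_sub_assoc, h1]
    rw [h5, hy, sub_add_cancel]
  · rintro u u' ⟨hu, hueq⟩ ⟨hu', hueq'⟩
    set n := N u - N u' with hn
    have hd : u - u' ∈ dom := dom.sub_mem hu hu'
    have heq : (ε : ℂ) • (u - u' - P (u - u')) + L (u - u') = -n := by
      have h1 := hueq.trans hueq'.symm
      rw [hLsub _ hu _ hu', map_sub, sub_sub_sub_comm, smul_sub, hn, neg_sub]
      rw [← sub_eq_zero] at h1 ⊢
      rw [← h1]
      abel
    set d := u - u' with hdd
    have hPd : L (P d) = -P n := by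
      rw [← map_neg, ← heq, map_add, hLP _ hd]; simp [hPP]
    have hQd : (ε : ℂ) • (d - P d) + L (d - P d) = -n + P n := by
      rw [← hQL _ hd, hPd, ← heq]; abel
    have h1 := (hNmono u u').trans (re_inner_le_of_projection P hPP hPs _ _)
    rw [← hn, ← hdd] at h1
    have h2 : (inner ℂ n (d - P d) : ℂ).re ≤ - (ε * ‖d - P d‖ ^ 2) := by
      have h3 : (inner ℂ n (d - P d) : ℂ) = inner ℂ (n - P n) (d - P d) := by
        rw [hQs]; simp [hPP]
      have h4 : n - P n = -((ε : ℂ) • (d - P d) + L (d - P d)) := by rw [hQd]; abel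
      have h5 : (inner ℂ (d - P d) (d - P d) : ℂ).re = ‖d - P d‖ ^ 2 :=
        inner_self_eq_norm_sq (𝕜 := ℂ) _
      have h6 := hnn₂ _ (dom.sub_mem hd (hPdom d)) (hP₁orth d)
      rw [h3, h4, inner_neg_left, inner_add_left, inner_smul_left, Complex.conj_ofReal,
        Complex.neg_re, Complex.add_re, Complex.re_ofReal_mul, h5]
      linarith
    have h3 : ‖P d‖ ≤ δ⁻¹ * ‖P n‖ := by
      rw [← div_eq_inv_mul, le_div_iff₀' hδ, ← norm_neg (P n), ← hPd]
      exact hlow _ (hP₁mem d)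
    have h4 := mul_le_mul_of_nonneg_left h3 (norm_nonneg (P n))
    have h5 := mul_nonneg hε.le (sq_nonneg ‖d - P d‖)
    have h6 := mul_nonneg (sub_pos.2 hα₀).le (sq_nonneg ‖P n‖)
    have h7 : (α - δ⁻¹) * ‖P n‖ ^ 2 = 0 := le_antisymm (by nlinarith) h6
    have h8 : ε * ‖d - P d‖ ^ 2 = 0 := le_antisymm (by nlinarith) h5
    have h9 : ‖P n‖ = 0 := by simpa [(sub_pos.2 hα₀).ne'] using h7
    have h10 : d - P d = 0 := by simpa [hε.ne'] using h8
    rw [h9, mul_zero] at h3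
    have h11 : P d = 0 := norm_le_zero_iff.1 h3
    rw [h11, sub_zero] at h10
    exact sub_eq_zero.1 h10
end

section
/- In the general spectral-gap setting, assume N : H → H is bounded, demicontinuous, N(0) = 0, and there exists α > γ/δ² such that Re⟨N(u) − N(u'), u − u'⟩ ≥ α‖P₁(N(u) − N(u'))‖² for all u, u' ∈ H; let h ∈ H. Suppose that for each sufficiently small ε > 0, u_ε ∈ dom L is a solution of the perturbed equation ε P₂u + Lu + N(u) = h, and that there is a constant C > 0 with ‖u_ε‖ ≤ C for all such ε. Then the equation Lu + N(u) = h has a solution u ∈ dom L. -/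
open Filter Topology

/-- A sequence whose squared increments are controlled by those of a bounded monotone real
sequence is Cauchy. -/
lemma cauchySeq_of_norm_sub_sq_le {E : Type*} [NormedAddCommGroup E] {u : ℕ → E} {b : ℕ → ℝ}
    {K : ℝ} (hb : Monotone b) (hbdd : BddAbove (Set.range b))
    (hu : ∀ n m, n ≤ m → ‖u n - u m‖ ^ 2 ≤ K * (b m - b n)) : CauchySeq u := by
  have hlim := tendsto_atTop_ciSup hb hbdd
  set l := ⨆ n, b n
  refine cauchySeq_of_le_tendsto_0' (fun n => √(|K| * (l - b n))) (fun n m hnm => ?_) ?_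
  · rw [dist_eq_norm]
    refine Real.le_sqrt_of_sq_le ((hu n m hnm).trans ?_)
    have h1 : b m ≤ l := le_ciSup hbdd m
    calc K * (b m - b n) ≤ |K| * (b m - b n) :=
          mul_le_mul_of_nonneg_right (le_abs_self K) (sub_nonneg.2 (hb hnm))
      _ ≤ |K| * (l - b n) := by gcongr
  · have : Tendsto (fun n => √(|K| * (l - b n))) atTop (𝓝 (√(|K| * (l - l)))) :=
      ((hlim.const_sub l).const_mul |K|).sqrt
    simpa using this

lemma two_mul_re_inner_smul_sub_smul {E : Type*} [NormedAddCommGroup E] [InnerProductSpace ℂ E]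
    (x y : E) (s t : ℝ) :
    2 * (inner ℂ ((s : ℂ) • x - (t : ℂ) • y) (x - y) : ℂ).re =
      (s + t) * ‖x - y‖ ^ 2 - (s - t) * (‖y‖ ^ 2 - ‖x‖ ^ 2) := by
  have hsub : ‖x - y‖ ^ 2 = ‖x‖ ^ 2 - 2 * (inner ℂ x y : ℂ).re + ‖y‖ ^ 2 :=
    norm_sub_sq (𝕜 := ℂ) x y
  have hx : (inner ℂ x x : ℂ).re = ‖x‖ ^ 2 := inner_self_eq_norm_sq (𝕜 := ℂ) x
  have hy : (inner ℂ y y : ℂ).re = ‖y‖ ^ 2 := inner_self_eq_norm_sq (𝕜 := ℂ) y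
  have hyx : (inner ℂ y x : ℂ).re = (inner ℂ x y : ℂ).re := inner_re_symm (𝕜 := ℂ) y x
  simp only [inner_sub_left, inner_sub_right, inner_smul_left, Complex.conj_ofReal,
    Complex.sub_re, Complex.re_ofReal_mul]
  rw [hsub, hx, hy, hyx]
  ring

lemma mul_norm_le_norm_of_re_inner_le {E : Type*} [NormedAddCommGroup E] [InnerProductSpace ℂ E]
    {a b : E} {δ : ℝ} (h : (inner ℂ b a : ℂ).re ≤ -δ * ‖a‖ ^ 2) : δ * ‖a‖ ≤ ‖b‖ := by
  have h1 : -(inner ℂ b a : ℂ).re ≤ ‖b‖ * ‖a‖ :=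
    (neg_le_abs _).trans ((Complex.abs_re_le_norm _).trans (norm_inner_le_norm b a))
  rcases (norm_nonneg a).eq_or_lt with h0 | h0
  · simp [← h0]
  · refine le_of_mul_le_mul_right ?_ h0
    nlinarith

/-- (General spectral-gap setting, limiting step.) Under the monotonicity
condition `Re⟪N(u) − N(u'), u − u'⟫ ≥ α‖P₁(N(u) − N(u'))‖²` with `α > γ/δ²`, if the perturbed
equations `ε P₂u + Lu + N(u) = h` have solutions `u_ε ∈ dom L` for all sufficiently small
`ε > 0` with `‖u_ε‖ ≤ C`, then `Lu + N(u) = h` has a solution in `dom L`. -/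
theorem stmt_15 {H : Type*} [NormedAddCommGroup H] [InnerProductSpace ℂ H] [CompleteSpace H]
    [TopologicalSpace.SeparableSpace H]
    (H₁ dom : Submodule ℂ H) (hcl : IsClosed (H₁ : Set H))
    (hdense : Dense (dom : Set H)) (hH₁dom : H₁ ≤ dom)
    (P₁ : H → H) (hP₁mem : ∀ u : H, P₁ u ∈ H₁) (hP₁orth : ∀ u : H, u - P₁ u ∈ H₁ᗮ)
    (L : H → H)
    (hlin : ∀ u ∈ dom, ∀ v ∈ dom, ∀ a b : ℂ, L (a • u + b • v) = a • L u + b • L v)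
    (hsymm : ∀ u ∈ dom, ∀ v ∈ dom, (inner ℂ (L u) v : ℂ) = inner ℂ u (L v))
    (hselfadj : ∀ v w : H, (∀ u ∈ dom, (inner ℂ v (L u) : ℂ) = inner ℂ w u) → v ∈ dom ∧ L v = w)
    (hinv₁ : ∀ u ∈ H₁, L u ∈ H₁)
    (hinv₂ : ∀ u ∈ dom, u ∈ H₁ᗮ → L u ∈ H₁ᗮ)
    (γ δ : ℝ) (hδ : 0 < δ) (hγδ : δ ≤ γ)
    (hcoer₁ : ∀ u ∈ H₁,
      -γ * ‖u‖ ^ 2 ≤ (inner ℂ (L u) u : ℂ).re ∧ (inner ℂ (L u) u : ℂ).re ≤ -δ * ‖u‖ ^ 2)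
    (hnn₂ : ∀ u ∈ dom, u ∈ H₁ᗮ → 0 ≤ (inner ℂ (L u) u : ℂ).re)
    (N : H → H)
    (hNbdd : ∀ s : Set H, Bornology.IsBounded s → Bornology.IsBounded (N '' s))
    (hNdemi : ∀ (u : ℕ → H) (u₀ : H), Tendsto u atTop (𝓝 u₀) →
      ∀ v : H, Tendsto (fun k => (inner ℂ v (N (u k)) : ℂ)) atTop (𝓝 (inner ℂ v (N u₀))))
    (hN0 : N 0 = 0)
    (hNmono : ∃ α : ℝ, γ / δ ^ 2 < α ∧ ∀ u u' : H,
      α * ‖P₁ (N u - N u')‖ ^ 2 ≤ (inner ℂ (N u - N u') (u - u') : ℂ).re)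
    (h : H)
    (hsol : ∃ ε₀ > (0 : ℝ), ∃ C > (0 : ℝ), ∀ ε : ℝ, 0 < ε → ε < ε₀ →
      ∃ u ∈ dom, (ε : ℂ) • (u - P₁ u) + L u + N u = h ∧ ‖u‖ ≤ C) :
    ∃ u ∈ dom, L u + N u = h := by
  obtain ⟨α, hα, hmono⟩ := hNmono
  obtain ⟨ε₀, hε₀, C, hC, hsol⟩ := hsol
  have hγ : 0 < γ := hδ.trans_le hγδ
  have hα0 : 0 < α := (by positivity : 0 < γ / δ ^ 2).trans hα
  have hκ : 0 < α * δ ^ 2 - γ := by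
    rw [div_lt_iff₀ (by positivity)] at hα
    linarith
  have hortho : ∀ a ∈ H₁, ∀ b ∈ H₁ᗮ, (inner ℂ a b : ℂ) = 0 ∧ (inner ℂ b a : ℂ) = 0 :=
    fun a ha b hb => ⟨Submodule.inner_right_of_mem_orthogonal ha hb,
      Submodule.inner_left_of_mem_orthogonal ha hb⟩
  have hadd : ∀ u ∈ dom, ∀ v ∈ dom, L (u + v) = L u + L v := fun u hu v hv => by
    simpa using hlin u hu v hv 1 1
  have hsub : ∀ u ∈ dom, ∀ v ∈ dom, L (u - v) = L u - L v := fun u hu v hv => by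
    simpa [sub_eq_add_neg] using hlin u hu v hv 1 (-1)
  have hP₁uniq : ∀ w, ∀ a ∈ H₁, w - a ∈ H₁ᗮ → P₁ w = a := fun w a ha hwa => by
    have h1 : P₁ w - a ∈ H₁ := H₁.sub_mem (hP₁mem w) ha
    have h2 : P₁ w - a ∈ H₁ᗮ := by
      convert H₁ᗮ.sub_mem hwa (hP₁orth w) using 1
      abel
    exact sub_eq_zero.1 (inner_self_eq_zero.1 (hortho _ h1 _ h2).1)
  have key : ∀ u ∈ dom, ∀ v ∈ dom, ∀ s t : ℝ, (s : ℂ) • (u - P₁ u) + L u + N u = h →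
      (t : ℂ) • (v - P₁ v) + L v + N v = h →
      2 * (α * δ ^ 2 - γ) * ‖P₁ u - P₁ v‖ ^ 2 +
        (s + t) * ‖(u - P₁ u) - (v - P₁ v)‖ ^ 2 ≤
          (s - t) * (‖v - P₁ v‖ ^ 2 - ‖u - P₁ u‖ ^ 2) := by
    intro u hu v hv s t hs ht
    have hid := two_mul_re_inner_smul_sub_smul (u - P₁ u) (v - P₁ v) s t
    have hx := hP₁orth u
    have hy := hP₁orth v
    have hxd : u - P₁ u ∈ dom := dom.sub_mem hu (hH₁dom (hP₁mem u))
    have hyd : v - P₁ v ∈ dom := dom.sub_mem hv (hH₁dom (hP₁mem v))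
    have huv : u - v = (P₁ u - P₁ v) + ((u - P₁ u) - (v - P₁ v)) := by abel
    have ha : P₁ u - P₁ v ∈ H₁ := H₁.sub_mem (hP₁mem u) (hP₁mem v)
    generalize u - P₁ u = x at *
    generalize v - P₁ v = y at *
    generalize P₁ u - P₁ v = a at *
    have hb : x - y ∈ H₁ᗮ := H₁ᗮ.sub_mem hx hy
    have hbd : x - y ∈ dom := dom.sub_mem hxd hyd
    have hz : (s : ℂ) • x - (t : ℂ) • y ∈ H₁ᗮ :=
      H₁ᗮ.sub_mem (H₁ᗮ.smul_mem _ hx) (H₁ᗮ.smul_mem _ hy)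
    have hL : L u - L v = L a + L (x - y) := by
      rw [← hsub u hu v hv, huv, hadd _ (hH₁dom ha) _ hbd]
    have hLa := hinv₁ a ha
    have hLb := hinv₂ _ hbd hb
    have hpos := hnn₂ _ hbd hb
    obtain ⟨hc1, hc2⟩ := hcoer₁ a ha
    have hm := hmono u v
    have hn : N u - N v = -L a - (L (x - y) + ((s : ℂ) • x - (t : ℂ) • y)) := by
      have h1 : N u - N v = -(L u - L v) - ((s : ℂ) • x - (t : ℂ) • y) := by
        rw [eq_sub_of_add_eq' hs, eq_sub_of_add_eq' ht]
        abel
      rw [h1, hL]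
      abel
    have hPn : P₁ (N u - N v) = -L a := by
      refine hP₁uniq _ _ (H₁.neg_mem hLa) ?_
      rw [hn, sub_sub_cancel_left]
      exact H₁ᗮ.neg_mem (H₁ᗮ.add_mem hLb hz)
    rw [hPn, norm_neg, hn, huv] at hm
    generalize (s : ℂ) • x - (t : ℂ) • y = z at *
    generalize x - y = b at *
    simp only [inner_sub_left, inner_add_left, inner_add_right, inner_neg_left,
      (hortho _ hLa _ hb).1, (hortho _ ha _ hLb).2, (hortho _ ha _ hz).2, Complex.sub_re,
      Complex.add_re, Complex.neg_re, Complex.zero_re] at hm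
    have hsq : (δ * ‖a‖) ^ 2 ≤ ‖L a‖ ^ 2 :=
      pow_le_pow_left₀ (by positivity) (mul_norm_le_norm_of_re_inner_le hc2) 2
    have := mul_le_mul_of_nonneg_left hsq hα0.le
    nlinarith
  set e : ℕ → ℝ := fun n => ε₀ / (n + 2) with he
  have he0 : ∀ n, 0 < e n := fun n => by positivity
  have he1 : ∀ n, e n < ε₀ := fun n => div_lt_self hε₀ (by
    have : (0 : ℝ) ≤ n := n.cast_nonneg
    linarith)
  have hanti : StrictAnti e := fun n m hnm => by
    have : (n : ℝ) < m := by exact_mod_cast hnm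
    simp only [he]
    gcongr
  have hetend : Tendsto e atTop (𝓝 0) :=
    tendsto_const_nhds.div_atTop (tendsto_atTop_add_const_right _ _ tendsto_natCast_atTop_atTop)
  choose u hud hueq huC using fun n => hsol (e n) (he0 n) (he1 n)
  have hpyth : ∀ a ∈ H₁, ∀ b ∈ H₁ᗮ, ‖a + b‖ ^ 2 = ‖a‖ ^ 2 + ‖b‖ ^ 2 := fun a ha b hb => by
    simpa only [sq] using
      norm_add_sq_eq_norm_sq_add_norm_sq_of_inner_eq_zero a b (hortho a ha b hb).1
  have hbd : ∀ n, ‖u n - P₁ (u n)‖ ^ 2 ≤ C ^ 2 := fun n => by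
    have h1 := hpyth _ (hP₁mem (u n)) _ (hP₁orth (u n))
    rw [add_sub_cancel] at h1
    have h2 := pow_le_pow_left₀ (norm_nonneg _) (huC n) 2
    have h3 := sq_nonneg ‖P₁ (u n)‖
    linarith
  have hb : Monotone fun n => ‖u n - P₁ (u n)‖ ^ 2 := by
    refine monotone_nat_of_le_succ fun n => ?_
    have h1 := key _ (hud n) _ (hud (n + 1)) _ _ (hueq n) (hueq (n + 1))
    have h2 : 0 < e n - e (n + 1) := sub_pos.2 (hanti n.lt_succ_self)
    have h3 := he0 n
    have h4 := he0 (n + 1)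
    refine sub_nonneg.1 (nonneg_of_mul_nonneg_right (le_trans ?_ h1) h2)
    positivity
  have hcauchy : CauchySeq u := by
    refine cauchySeq_of_norm_sub_sq_le (K := 1 + ε₀ / (2 * (α * δ ^ 2 - γ))) hb
      ⟨C ^ 2, by rintro _ ⟨n, rfl⟩; exact hbd n⟩ fun n m hnm => ?_
    have h1 := key _ (hud n) _ (hud m) _ _ (hueq n) (hueq m)
    have hsplit : u n - u m =
        (P₁ (u n) - P₁ (u m)) + ((u n - P₁ (u n)) - (u m - P₁ (u m))) := by abel
    rw [hsplit, hpyth _ (H₁.sub_mem (hP₁mem _) (hP₁mem _)) _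
      (H₁ᗮ.sub_mem (hP₁orth _) (hP₁orth _))]
    have hD : 0 ≤ ‖u m - P₁ (u m)‖ ^ 2 - ‖u n - P₁ (u n)‖ ^ 2 := sub_nonneg.2 (hb hnm)
    have hn0 := he0 n
    have hm0 := he0 m
    have hn1 := he1 n
    have hA := sq_nonneg ‖P₁ (u n) - P₁ (u m)‖
    have hB := sq_nonneg ‖(u n - P₁ (u n)) - (u m - P₁ (u m))‖
    generalize ‖P₁ (u n) - P₁ (u m)‖ ^ 2 = A at *
    generalize ‖(u n - P₁ (u n)) - (u m - P₁ (u m))‖ ^ 2 = B at *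
    generalize ‖u m - P₁ (u m)‖ ^ 2 - ‖u n - P₁ (u n)‖ ^ 2 = D at *
    generalize α * δ ^ 2 - γ = κ at *
    have hBD : B ≤ D := by
      refine le_of_mul_le_mul_left ?_ (add_pos hn0 hm0)
      nlinarith [mul_nonneg hκ.le hA, mul_nonneg hm0.le hD]
    have hAD : A ≤ ε₀ / (2 * κ) * D := by
      rw [div_mul_eq_mul_div, le_div_iff₀ (by positivity)]
      nlinarith [mul_nonneg (add_pos hn0 hm0).le hB, mul_nonneg hm0.le hD,
        mul_nonneg (sub_pos.2 hn1).le hD]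
    linarith
  obtain ⟨w, hw⟩ := cauchySeq_tendsto_of_complete hcauchy
  have hsmall : Tendsto (fun n => (e n : ℂ) • (u n - P₁ (u n))) atTop (𝓝 0) := by
    refine squeeze_zero_norm (a := fun n => e n * C) (fun n => ?_)
      (by simpa using hetend.mul_const C)
    rw [norm_smul, Complex.norm_real, Real.norm_of_nonneg (he0 n).le]
    exact mul_le_mul_of_nonneg_left (le_of_abs_le (abs_le_of_sq_le_sq (hbd n) hC.le)) (he0 n).le
  have hfin := hselfadj w (h - N w) fun v hv => by
    have h1 : Tendsto (fun n => (inner ℂ (L v) (u n) : ℂ)) atTop (𝓝 (inner ℂ (L v) w)) :=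
      tendsto_const_nhds.inner hw
    have h2 : Tendsto (fun n => (inner ℂ v h - inner ℂ v ((e n : ℂ) • (u n - P₁ (u n))) -
        inner ℂ v (N (u n)) : ℂ)) atTop (𝓝 (inner ℂ v h - inner ℂ v 0 - inner ℂ v (N w))) :=
      (tendsto_const_nhds.sub (tendsto_const_nhds.inner hsmall)).sub (hNdemi u w hw v)
    have h3 : ∀ n, (inner ℂ v h - inner ℂ v ((e n : ℂ) • (u n - P₁ (u n))) -
        inner ℂ v (N (u n)) : ℂ) = inner ℂ (L v) (u n) := fun n => by
      rw [hsymm v hv _ (hud n), ← inner_sub_right, ← inner_sub_right, ← hueq n]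
      congr 1
      abel
    have h4 := tendsto_nhds_unique h1 (h2.congr h3)
    rw [inner_zero_right, sub_zero, ← inner_sub_right] at h4
    rw [← inner_conj_symm w, h4, inner_conj_symm]
  exact ⟨w, hfin.1, by rw [hfin.2]; abel⟩
end
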